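/- arXiv:2203.05730 — 2 statements merged into one kernel-verified Lean document; each statement's English description precedes it below -/
import Mathlib

section
/- Fix U, V ∈ ℂ with e^V = 1 + e^U, let k̂ be an even integer, and let n₀ ∈ {1, 3, 5, 7}. For each odd positive integer n set q = exp(2πi/n), u = e^{U/n}, v = e^{V/n}, and Σₙ = Σ_{i=1}^{n} QDL^q(u, v | 2i) · q^{2i² − k̂ i}. Then, as n tends to ∞ along odd integers with n ≡ n₀ (mod 8), Σₙ / (√n · e^{(n/(2π))·Λ(π/6)}) converges to 3^{−1/4} · 2^{(U−2πi)/(4πi)} · e^{−n₀ πi/4} · e^{−2 k̂ πi/3} · e^{−2V/3} · (1 − i^{n₀} e^{U/2}) · ((1 − i√3)/2)^{(2πi−U)/(4πi)}. -/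
open Filter

/-- The discrete quantum dilogarithm `QDL^q(u,v | i) = v^{-i} ∏_{j=1}^i (1 + u q^{-2j})`
for a natural index `i`, with `q = exp(2πi/n)`. -/
noncomputable def qdlAux (n : ℕ) (u v : ℂ) (i : ℕ) : ℂ :=
  v⁻¹ ^ i * ∏ k ∈ Finset.range i,
    (1 + u * Complex.exp (2 * Real.pi * Complex.I / n) ^ (-(2 * ((k : ℤ) + 1))))

/-- The discrete quantum dilogarithm, extended to all integer indices by `n`-periodicity. -/
noncomputable def QDL (n : ℕ) (u v : ℂ) (i : ℤ) : ℂ :=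
  qdlAux n u v ((i % (n : ℤ)).toNat)

/-- The Lobachevsky function `Λ(θ) = -∫₀^θ log |2 sin t| dt`. -/
noncomputable def lob (θ : ℝ) : ℝ := -∫ t in (0:ℝ)..θ, Real.log |2 * Real.sin t|

section Generic
open Topology MeasureTheory

theorem norm_prod_one_add_le (s : Finset ℕ) (ε : ℕ → ℂ) :
    ‖∏ l ∈ s, (1 + ε l)‖ ≤ Real.exp (∑ l ∈ s, ‖ε l‖) := by
  rw [norm_prod, Real.exp_sum]
  refine Finset.prod_le_prod (fun _ _ => norm_nonneg _) fun l _ => ?_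
  calc ‖1 + ε l‖ ≤ 1 + ‖ε l‖ := by simpa using norm_add_le 1 (ε l)
    _ ≤ Real.exp ‖ε l‖ := by linarith [Real.add_one_le_exp ‖ε l‖]

/-- Products of factors uniformly close to `1` converge to the exponential of the limit of the
sums of their deviations from `1`. -/
theorem tendsto_prod_one_add {ι : Type*} {F : Filter ι} {ε : ι → ℕ → ℂ} {r : ι → ℕ} {δ : ι → ℝ}
    {s : ℂ} {C : ℝ} (hδ0 : ∀ m, 0 ≤ δ m) (hδ : Tendsto δ F (𝓝 0))
    (hε : ∀ᶠ m in F, ∀ l < r m, ‖ε m l‖ ≤ δ m)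
    (hr : ∀ᶠ m in F, r m * δ m ≤ C)
    (hs : Tendsto (fun m => ∑ l ∈ Finset.range (r m), ε m l) F (𝓝 s)) :
    Tendsto (fun m => ∏ l ∈ Finset.range (r m), (1 + ε m l)) F (𝓝 (Complex.exp s)) := by
  have hsmall : ∀ᶠ m in F, δ m ≤ 1 / 2 := hδ.eventually_le_const (by norm_num)
  have key : Tendsto (fun m => ∑ l ∈ Finset.range (r m), Complex.log (1 + ε m l)) F (𝓝 s) := by
    have : Tendsto (fun m => ∑ l ∈ Finset.range (r m), (Complex.log (1 + ε m l) - ε m l))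
        F (𝓝 0) := by
      refine squeeze_zero_norm' (a := fun m => C * δ m) ?_ (by simpa using hδ.const_mul C)
      filter_upwards [hsmall, hε, hr] with m h1 h2 h3
      calc _ ≤ ∑ l ∈ Finset.range (r m), ‖Complex.log (1 + ε m l) - ε m l‖ := norm_sum_le _ _
        _ ≤ ∑ l ∈ Finset.range (r m), δ m * δ m := by
          refine Finset.sum_le_sum fun l hl => ?_
          have hl' := h2 l (Finset.mem_range.1 hl)
          have h0 := norm_nonneg (ε m l)
          have hinv : (1 - ‖ε m l‖)⁻¹ ≤ 2 := by
            rw [inv_le_comm₀ (by linarith) two_pos]; linarith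
          calc _ ≤ ‖ε m l‖ ^ 2 * (1 - ‖ε m l‖)⁻¹ / 2 :=
                Complex.norm_log_one_add_sub_self_le (by linarith)
            _ ≤ ‖ε m l‖ ^ 2 * 2 / 2 := by gcongr
            _ = ‖ε m l‖ * ‖ε m l‖ := by ring
            _ ≤ δ m * δ m := by gcongr; linarith
        _ = (r m * δ m) * δ m := by simp; ring
        _ ≤ C * δ m := by
          have := hδ0 m
          gcongr
    simpa using this.add hs
  refine (key.cexp).congr' ?_
  filter_upwards [hsmall, hε] with m h1 h2
  rw [Complex.exp_sum]
  refine Finset.prod_congr rfl fun l hl => Complex.exp_log fun h0 => ?_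
  have hl' := h2 l (Finset.mem_range.1 hl)
  rw [show ε m l = -1 by linear_combination h0, norm_neg, norm_one] at hl'
  linarith

/-- A sum over an initial segment of `ℕ`, rescaled as the integral of a step function, converges by
dominated convergence. -/
theorem tendsto_sum_div_of_dominated {ι : Type*} {F : Filter ι} [F.IsCountablyGenerated]
    (b : ι → ℕ → ℂ) (J : ι → ℕ) (a s : ι → ℝ) (hs : ∀ᶠ m in F, 0 < s m) (bound : ℝ → ℝ)
    (hbound : Integrable bound) (h0 : ∀ x, 0 ≤ bound x)
    (hb : ∀ᶠ m in F, ∀ x, ∀ j < J m, (j : ℝ) ≤ a m + s m * x → a m + s m * x < j + 1 →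
      ‖b m j‖ ≤ bound x) (φ : ℝ → ℂ)
    (hlim : ∀ᵐ x, Tendsto (fun m => if 0 ≤ a m + s m * x ∧ ⌊a m + s m * x⌋₊ < J m then
      b m ⌊a m + s m * x⌋₊ else 0) F (𝓝 (φ x))) :
    Tendsto (fun m => (∑ j ∈ Finset.range (J m), b m j) / (s m : ℂ)) F (𝓝 (∫ x, φ x)) := by
  set G : ι → ℝ → ℂ := fun m y => ∑ j ∈ Finset.range (J m),
    (Set.Ico (j : ℝ) (j + 1)).indicator (fun _ => b m j) y with hG
  have hGe : ∀ m y, G m y = if 0 ≤ y ∧ ⌊y⌋₊ < J m then b m ⌊y⌋₊ else 0 := by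
    intro m y
    split_ifs with h
    · rw [hG]
      simp only
      rw [Finset.sum_eq_single_of_mem ⌊y⌋₊ (Finset.mem_range.2 h.2)]
      · rw [Set.indicator_of_mem]
        exact ⟨Nat.floor_le h.1, Nat.lt_floor_add_one y⟩
      · intro j _ hj
        rw [Set.indicator_of_notMem]
        rintro ⟨h1, h2⟩
        exact hj ((Nat.floor_eq_iff h.1).2 ⟨h1, h2⟩).symm
    · refine Finset.sum_eq_zero fun j hj => Set.indicator_of_notMem ?_ _
      rintro ⟨h1, h2⟩
      have hy : 0 ≤ y := le_trans (Nat.cast_nonneg j) h1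
      refine h ⟨hy, ?_⟩
      rw [(Nat.floor_eq_iff hy).2 ⟨h1, h2⟩]
      exact Finset.mem_range.1 hj
  have hGint : ∀ m, ∫ y, G m y = ∑ j ∈ Finset.range (J m), b m j := by
    intro m
    rw [hG]
    simp only
    rw [integral_finsetSum]
    · refine Finset.sum_congr rfl fun j _ => ?_
      rw [integral_indicator measurableSet_Ico]
      simp
    · intro j _
      rw [integrable_indicator_iff measurableSet_Ico]
      exact integrableOn_const (by simp)
  have hGm : ∀ m, Measurable (G m) := fun m =>
    Finset.measurable_sum _ fun j _ => measurable_const.indicator measurableSet_Ico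
  have main : Tendsto (fun m => ∫ x, G m (a m + s m * x)) F (𝓝 (∫ x, φ x)) := by
    refine tendsto_integral_filter_of_dominated_convergence bound ?_ ?_ hbound ?_
    · exact Eventually.of_forall fun m =>
        ((hGm m).comp (by fun_prop : Measurable fun x : ℝ => a m + s m * x)).aestronglyMeasurable
    · filter_upwards [hb] with m hm
      refine Eventually.of_forall fun x => ?_
      rw [hGe]
      split_ifs with h
      · exact hm x _ h.2 (Nat.floor_le h.1) (Nat.lt_floor_add_one _)
      · simpa using h0 x
    · simpa only [hGe] using hlim
  refine main.congr' ?_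
  filter_upwards [hs] with m hm
  rw [← hGint m]
  have h1 := Measure.integral_comp_mul_left (fun y => G m (a m + y)) (s m)
  rw [integral_add_left_eq_self (G m) (a m)] at h1
  rw [h1, abs_of_pos (inv_pos.2 hm)]
  rw [Complex.real_smul]
  push_cast
  field_simp

theorem prod_two_mul_sin (N : ℕ) (hN : 0 < N) (x : ℂ) :
    ∏ l ∈ Finset.range N, (2 * Complex.sin ((x + Real.pi * l) / N)) = 2 * Complex.sin x := by
  have hN' : (N : ℂ) ≠ 0 := Nat.cast_ne_zero.2 hN.ne'
  have hζ := Complex.isPrimitiveRoot_exp N hN.ne'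
  have hX := congrArg (Polynomial.eval 1)
    (X_pow_sub_C_eq_prod hζ hN (α := Complex.exp (2 * Complex.I * x / N)) rfl)
  simp only [Polynomial.eval_sub, Polynomial.eval_pow, Polynomial.eval_X, Polynomial.eval_C,
    Polynomial.eval_prod, one_pow] at hX
  have key : ∀ z : ℂ, 2 * Complex.sin z =
      Complex.exp (Real.pi / 2 * Complex.I - Complex.I * z) *
        (1 - Complex.exp (2 * Complex.I * z)) := by
    intro z
    rw [Complex.sin, sub_eq_add_neg (_ * _) (Complex.I * z), Complex.exp_add, Complex.exp_pi_div_two_mul_I, mul_assoc Complex.I,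
      mul_sub, mul_one, ← Complex.exp_add]
    ring_nf
  have hsum : ∀ n : ℕ, ∏ l ∈ Finset.range n,
      Complex.exp (Real.pi / 2 * Complex.I - Complex.I * ((x + Real.pi * l) / N)) =
      Complex.exp (n * (Real.pi * Complex.I / 2 - Complex.I * x / N)
        - Complex.I * Real.pi * (n * (n - 1) / 2) / N) := by
    intro n
    induction n with
    | zero => simp
    | succ n ih =>
      rw [Finset.prod_range_succ, ih, ← Complex.exp_add]
      congr 1
      push_cast
      ring
  simp_rw [key]
  rw [Finset.prod_mul_distrib, hsum]
  congr 1
  · congr 1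
    field_simp
    ring
  · rw [← Complex.exp_nat_mul] at hX
    rw [show 2 * Complex.I * x = N * (2 * Complex.I * x / N) by field_simp, hX]
    refine Finset.prod_congr rfl fun l _ => ?_
    rw [← Complex.exp_nat_mul, ← Complex.exp_add]
    congr 2
    ring

end Generic

section LogCos
open Topology MeasureTheory Real

/-- The logarithm of `2 cos (2πt)`. -/
noncomputable def logCos (t : ℝ) : ℝ := Real.log (2 * Real.cos (2 * π * t))

/-- The primitive of `logCos` vanishing at `0`. -/
noncomputable def logCosInt (t : ℝ) : ℝ := ∫ s in (0 : ℝ)..t, logCos s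

theorem one_fifth_le_cos {t : ℝ} (h0 : 0 ≤ t) (h1 : t ≤ 1 / 5) : 1 / 5 ≤ Real.cos (2 * π * t) := by
  have hπ := Real.pi_pos
  have := Real.one_sub_mul_le_cos (x := 2 * π * t) (by positivity) (by nlinarith)
  have h : 2 / π * (2 * π * t) = 4 * t := by field_simp; ring
  rw [h] at this
  linarith

theorem hasDerivAt_logCos {t : ℝ} (h : Real.cos (2 * π * t) ≠ 0) :
    HasDerivAt logCos (-(2 * π) * Real.tan (2 * π * t)) t := by
  have h1 : HasDerivAt (fun t : ℝ => 2 * π * t) (2 * π) t := by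
    simpa using (hasDerivAt_id t).const_mul (2 * π)
  have h2 := ((h1.cos).const_mul 2).log (mul_ne_zero two_ne_zero h)
  refine h2.congr_deriv ?_
  rw [Real.tan_eq_sin_div_cos]
  field_simp

theorem continuousOn_logCos : ContinuousOn logCos (Set.Icc 0 (1 / 5)) := fun _ ht =>
  (hasDerivAt_logCos (by linarith [one_fifth_le_cos ht.1 ht.2])).continuousAt.continuousWithinAt

theorem intervalIntegrable_logCos {a b : ℝ} (ha : a ∈ Set.Icc (0 : ℝ) (1 / 5))
    (hb : b ∈ Set.Icc (0 : ℝ) (1 / 5)) : IntervalIntegrable logCos volume a b :=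
  (continuousOn_logCos.mono (Set.uIcc_subset_Icc ha hb)).intervalIntegrable

theorem logCosInt_sub {a b : ℝ} (ha : a ∈ Set.Icc (0 : ℝ) (1 / 5))
    (hb : b ∈ Set.Icc (0 : ℝ) (1 / 5)) :
    logCosInt b - logCosInt a = ∫ s in a..b, logCos s :=
  intervalIntegral.integral_interval_sub_left
    (intervalIntegrable_logCos (by constructor <;> norm_num) hb)
    (intervalIntegrable_logCos (by constructor <;> norm_num) ha)

theorem logCos_trapezoid {n r : ℕ} (hn : 0 < n) (hr : 5 * r ≤ n) :
    |∑ l ∈ Finset.range r, logCos (((l + 1 : ℕ) : ℝ) / n) - n * logCosInt (r / n)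
      - (logCos (r / n) - logCos 0) / 2| ≤ 100 * π ^ 2 / n := by
  have hn' : (0 : ℝ) < n := Nat.cast_pos.2 hn
  rcases Nat.eq_zero_or_pos r with rfl | hr0
  · simp [logCosInt]
    positivity
  have hr' : (0 : ℝ) < r := Nat.cast_pos.2 hr0
  have hrn : (5 : ℝ) * r ≤ n := by exact_mod_cast hr
  set b : ℝ := r / n with hb
  have hb0 : 0 < b := by positivity
  have hb1 : b ≤ 1 / 5 := by rw [hb, div_le_iff₀ hn']; linarith
  set s := Set.uIcc (0 : ℝ) b with hs
  have hsI : s = Set.Icc 0 b := Set.uIcc_of_le hb0.le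
  have hu : UniqueDiffOn ℝ s := hsI ▸ uniqueDiffOn_Icc hb0
  have hcos : ∀ x ∈ s, 1 / 5 ≤ Real.cos (2 * π * x) := fun x hx => by
    rw [hsI] at hx
    exact one_fifth_le_cos hx.1 (hx.2.trans hb1)
  have hd1 : ∀ x ∈ s, HasDerivWithinAt logCos (-(2 * π) * Real.tan (2 * π * x)) s x :=
    fun x hx => (hasDerivAt_logCos (by linarith [hcos x hx])).hasDerivWithinAt
  have hdw : ∀ x ∈ s, derivWithin logCos s x = -(2 * π) * Real.tan (2 * π * x) :=
    fun x hx => (hd1 x hx).derivWithin (hu x hx)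
  have hd2 : ∀ x ∈ s, HasDerivWithinAt (derivWithin logCos s)
      (-(2 * π) * (1 / Real.cos (2 * π * x) ^ 2 * (2 * π))) s x := by
    intro x hx
    have h1 : HasDerivAt (fun t : ℝ => 2 * π * t) (2 * π) x := by
      simpa using (hasDerivAt_id x).const_mul (2 * π)
    have h2 := ((Real.hasDerivAt_tan (x := 2 * π * x) (by linarith [hcos x hx])).comp x h1).const_mul
      (-(2 * π))
    exact h2.hasDerivWithinAt.congr (fun y hy => hdw y hy) (hdw x hx)
  have hbound : ∀ x, |iteratedDerivWithin 2 logCos s x| ≤ 100 * π ^ 2 := by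
    intro x
    rw [iteratedDerivWithin_succ, iteratedDerivWithin_one]
    by_cases hx : x ∈ s
    · rw [(hd2 x hx).derivWithin (hu x hx)]
      have h5 := hcos x hx
      have : 1 / Real.cos (2 * π * x) ^ 2 ≤ 25 := by
        rw [div_le_iff₀ (by positivity)]
        nlinarith
      rw [abs_mul, abs_neg, abs_of_pos (by positivity), abs_of_nonneg (by positivity)]
      nlinarith [Real.pi_pos, sq_nonneg π]
    · rw [derivWithin_zero_of_notMem_closure]
      · simp; positivity
      · rwa [hsI, isClosed_Icc.closure_eq, ← hsI]
  have := trapezoidal_error_le (f := logCos) (a := 0) (b := b)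
    (fun x hx => (hd1 x hx).differentiableWithinAt) (fun x hx => (hd2 x hx).differentiableWithinAt)
    hbound hr0
  rw [trapezoidal_error, trapezoidal_integral] at this
  obtain ⟨r, rfl⟩ : ∃ k, r = k + 1 := ⟨r - 1, by omega⟩
  have hsum : ∑ k ∈ Finset.range (r + 1 - 1), logCos (0 + (k + 1) * (b - 0) / (r + 1 : ℕ)) =
      ∑ l ∈ Finset.range r, logCos (((l + 1 : ℕ) : ℝ) / n) := by
    refine Finset.sum_congr rfl fun k _ => ?_
    congr 1
    rw [hb]
    push_cast at hr' ⊢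
    field_simp
    ring
  rw [hsum] at this
  rw [Finset.sum_range_succ, ← hb]
  change |_ - logCosInt b| ≤ _ at this
  have hbr : (b - 0) / ((r + 1 : ℕ) : ℝ) = 1 / n := by rw [hb]; field_simp; ring
  rw [hbr, sub_zero, abs_of_pos hb0] at this
  have e : ∑ x ∈ Finset.range r, logCos (((x + 1 : ℕ) : ℝ) / n) + logCos b - n * logCosInt b
      - (logCos b - logCos 0) / 2 = n * (1 / n * ((logCos 0 + logCos b) / 2 +
        ∑ l ∈ Finset.range r, logCos (((l + 1 : ℕ) : ℝ) / n)) - logCosInt b) := by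
    field_simp
    ring
  rw [e, abs_mul, abs_of_pos hn']
  calc _ ≤ n * (b ^ 3 * (100 * π ^ 2) / (12 * ((r + 1 : ℕ) : ℝ) ^ 2)) := by gcongr
    _ = (100 * π ^ 2 / n) * (b / 12) := by rw [hb]; field_simp
    _ ≤ (100 * π ^ 2 / n) * 1 := by gcongr; linarith
    _ = _ := mul_one _

theorem two_mul_cos_shift (s : ℝ) : 2 * Real.cos (2 * π * s) =
    Real.cos (2 * π * (s - 1 / 6)) - √3 * Real.sin (2 * π * (s - 1 / 6)) := by
  rw [show 2 * π * s = π / 3 + 2 * π * (s - 1 / 6) by ring, Real.cos_add, Real.cos_pi_div_three,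
    Real.sin_pi_div_three]
  ring

theorem logCos_le {s : ℝ} (h0 : 1 / 6 ≤ s) (h1 : s ≤ 1 / 5) : logCos s ≤ -(s - 1 / 6) := by
  have hπ := Real.pi_gt_three
  have hc := one_fifth_le_cos (by linarith) h1
  have h := two_mul_cos_shift s
  have hs := Real.mul_le_sin (x := 2 * π * (s - 1 / 6)) (by nlinarith) (by nlinarith)
  have he : 2 / π * (2 * π * (s - 1 / 6)) = 4 * (s - 1 / 6) := by field_simp; ring
  rw [he] at hs
  have h3 : 1 ≤ √3 := Real.one_le_sqrt.2 (by norm_num)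
  have := Real.log_le_sub_one_of_pos (x := 2 * Real.cos (2 * π * s)) (by linarith)
  rw [logCos]
  nlinarith [Real.cos_le_one (2 * π * (s - 1 / 6))]

theorem le_logCos {s : ℝ} (h0 : 0 ≤ s) (h1 : s ≤ 1 / 6) : 1 / 6 - s ≤ logCos s := by
  have hπ := Real.pi_gt_three
  have h := two_mul_cos_shift s
  rw [show 2 * π * (s - 1 / 6) = -(2 * π * (1 / 6 - s)) by ring, Real.cos_neg, Real.sin_neg] at h
  have hs := Real.mul_le_sin (x := 2 * π * (1 / 6 - s)) (by nlinarith) (by nlinarith)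
  have hc := Real.one_sub_mul_le_cos (x := 2 * π * (1 / 6 - s)) (by nlinarith) (by nlinarith)
  have he : 2 / π * (2 * π * (1 / 6 - s)) = 4 * (1 / 6 - s) := by field_simp; ring
  rw [he] at hs hc
  have h3 : 17 / 10 ≤ √3 := Real.le_sqrt_of_sq_le (by norm_num)
  have h2 : 1 + 2 * (1 / 6 - s) ≤ 2 * Real.cos (2 * π * s) := by nlinarith
  rw [logCos, Real.le_log_iff_exp_le (by linarith)]
  refine le_trans ?_ h2
  have := Real.exp_bound_div_one_sub_of_interval (x := 1 / 6 - s) (by linarith) (by linarith)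
  refine this.trans ?_
  rw [div_le_iff₀ (by linarith)]
  nlinarith

theorem logCosInt_le {t : ℝ} (h0 : 0 ≤ t) (h1 : t ≤ 1 / 5) :
    logCosInt t ≤ logCosInt (1 / 6) - (t - 1 / 6) ^ 2 / 2 := by
  have h6 : (1 / 6 : ℝ) ∈ Set.Icc (0 : ℝ) (1 / 5) := by constructor <;> norm_num
  rcases le_total t (1 / 6) with h | h
  · have h2 := logCosInt_sub ⟨h0, h1⟩ h6
    have h3 : ∫ s in t..(1 / 6), (1 / 6 - s) ≤ ∫ s in t..(1 / 6), logCos s :=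
      intervalIntegral.integral_mono_on h (Continuous.intervalIntegrable (by fun_prop) _ _)
        (intervalIntegrable_logCos ⟨h0, h1⟩ h6)
        fun x hx => le_logCos (h0.trans hx.1) hx.2
    have h4 : ∫ s in t..(1 / 6), (1 / 6 - s) = (t - 1 / 6) ^ 2 / 2 := by
      rw [intervalIntegral.integral_sub (by simp) (by simp), integral_id]
      simp
      ring
    linarith
  · have h2 := logCosInt_sub h6 ⟨h0, h1⟩
    have h3 : ∫ s in (1 / 6)..t, logCos s ≤ ∫ s in (1 / 6)..t, -(s - 1 / 6) :=
      intervalIntegral.integral_mono_on h (intervalIntegrable_logCos h6 ⟨h0, h1⟩)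
        (Continuous.intervalIntegrable (by fun_prop) _ _)
        fun x hx => logCos_le hx.1 (hx.2.trans h1)
    have h4 : ∫ s in (1 / 6)..t, -(s - 1 / 6) = -((t - 1 / 6) ^ 2 / 2) := by
      rw [intervalIntegral.integral_neg, intervalIntegral.integral_sub (by simp) (by simp),
        integral_id]
      simp
      ring
    linarith

theorem logCos_one_sixth : logCos (1 / 6) = 0 := by
  rw [logCos, show 2 * π * (1 / 6) = π / 3 by ring, Real.cos_pi_div_three]
  norm_num

theorem logCosInt_sub_isLittleO : (fun t => logCosInt t - logCosInt (1 / 6)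
    + π * √3 * (t - 1 / 6) ^ 2) =o[𝓝 (1 / 6)] fun t => (t - 1 / 6) ^ 2 := by
  have hd : HasDerivAt logCos (-(2 * π * √3)) (1 / 6) := by
    have hc := one_fifth_le_cos (t := 1 / 6) (by norm_num) (by norm_num)
    refine (hasDerivAt_logCos (by linarith)).congr_deriv ?_
    rw [show 2 * π * (1 / 6) = π / 3 by ring, Real.tan_pi_div_three]
    ring
  rw [hasDerivAt_iff_isLittleO] at hd
  rw [Asymptotics.isLittleO_iff] at hd ⊢
  intro c hc
  have h1 := hd hc
  obtain ⟨δ, hδ, hball⟩ := Metric.eventually_nhds_iff.1 h1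
  refine Metric.eventually_nhds_iff.2 ⟨min δ (1 / 30), by positivity, fun t ht => ?_⟩
  rw [Real.dist_eq] at ht
  have ht1 : |t - 1 / 6| < δ := ht.trans_le (min_le_left _ _)
  have ht2 := abs_lt.1 (ht.trans_le (min_le_right _ _))
  have h6 : (1 / 6 : ℝ) ∈ Set.Icc (0 : ℝ) (1 / 5) := by constructor <;> norm_num
  have htI : t ∈ Set.Icc (0 : ℝ) (1 / 5) := by constructor <;> linarith [ht2.1, ht2.2]
  have e : logCosInt t - logCosInt (1 / 6) + π * √3 * (t - 1 / 6) ^ 2 =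
      ∫ s in (1 / 6)..t, (logCos s + 2 * π * √3 * (s - 1 / 6)) := by
    rw [intervalIntegral.integral_add (intervalIntegrable_logCos h6 htI)
      (Continuous.intervalIntegrable (by fun_prop) _ _), ← logCosInt_sub h6 htI,
      intervalIntegral.integral_const_mul, intervalIntegral.integral_sub (by simp) (by simp),
        integral_id]
    simp
    ring
  rw [e]
  have := intervalIntegral.norm_integral_le_of_norm_le_const (a := 1 / 6) (b := t)
    (f := fun s => logCos s + 2 * π * √3 * (s - 1 / 6)) (C := c * |t - 1 / 6|) ?_
  · refine this.trans (le_of_eq ?_)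
    rw [Real.norm_eq_abs, abs_pow]
    ring
  · intro s hs
    have hs' : |s - 1 / 6| ≤ |t - 1 / 6| := by
      have := Set.abs_sub_left_of_mem_uIcc (Set.uIoc_subset_uIcc hs)
      simpa using this
    have := hball (y := s) (by rw [Real.dist_eq]; linarith)
    rw [logCos_one_sixth] at this
    simp only [sub_zero, smul_eq_mul] at this
    calc ‖logCos s + 2 * π * √3 * (s - 1 / 6)‖ = ‖logCos s - (s - 1 / 6) * -(2 * π * √3)‖ := by
          congr 1; ring
      _ ≤ c * ‖s - 1 / 6‖ := this
      _ ≤ _ := by rw [Real.norm_eq_abs]; gcongr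

/-- The quadratic limit of `logCosInt` around its maximum. -/
theorem tendsto_logCosInt {ι : Type*} {F : Filter ι} {n t : ι → ℝ} {x : ℝ}
    (hn0 : ∀ᶠ m in F, 0 < n m) (ht : Tendsto t F (𝓝 (1 / 6)))
    (hx : Tendsto (fun m => √(n m) * (t m - 1 / 6)) F (𝓝 x)) :
    Tendsto (fun m => n m * (logCosInt (t m) - logCosInt (1 / 6))) F (𝓝 (-(π * √3 * x ^ 2))) := by
  have hsq : Tendsto (fun m => n m * (t m - 1 / 6) ^ 2) F (𝓝 (x ^ 2)) := by
    refine (hx.pow 2).congr' ?_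
    filter_upwards [hn0] with m hm
    rw [mul_pow, Real.sq_sqrt hm.le]
  have h1 := logCosInt_sub_isLittleO.comp_tendsto ht
  have h2 : (fun m => n m * (logCosInt (t m) - logCosInt (1 / 6)
      + π * √3 * (t m - 1 / 6) ^ 2)) =o[F] fun m => n m * (t m - 1 / 6) ^ 2 :=
    (Asymptotics.isBigO_refl n F).mul_isLittleO h1
  have h3 := (h2.trans_isBigO (hsq.isBigO_one ℝ))
  rw [Asymptotics.isLittleO_one_iff] at h3
  have h4 := h3.sub (hsq.const_mul (π * √3))
  rw [zero_sub] at h4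
  refine h4.congr fun m => ?_
  ring

end LogCos

section Dil
open Topology MeasureTheory Real

/-- Riemann sums of uniformly bounded, pointwise converging samples. -/
theorem tendsto_riemann_sum {ι : Type*} {F : Filter ι} [F.IsCountablyGenerated] {n r : ι → ℕ}
    (hn : Tendsto n F atTop) (hr : ∀ᶠ m in F, r m ≤ n m) {τ : ℝ} (hτ0 : 0 ≤ τ)
    (hτ : Tendsto (fun m => (r m : ℝ) / n m) F (𝓝 τ)) {b : ι → ℕ → ℂ} {K : ℝ} (hK : 0 ≤ K)
    (hb : ∀ᶠ m in F, ∀ l < r m, ‖b m l‖ ≤ K) {h : ℝ → ℂ}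
    (hlim : ∀ x, 0 < x → x < τ → Tendsto (fun m => b m ⌊n m * x⌋₊) F (𝓝 (h x))) :
    Tendsto (fun m => (∑ l ∈ Finset.range (r m), b m l) / (n m : ℂ)) F
      (𝓝 (∫ x in (0 : ℝ)..τ, h x)) := by
  have hpos : ∀ᶠ m in F, 0 < n m := hn.eventually_gt_atTop 0
  have := tendsto_sum_div_of_dominated (F := F) b r (fun _ => 0) (fun m => (n m : ℝ))
    (hpos.mono fun m hm => Nat.cast_pos.2 hm) ((Set.Icc (0 : ℝ) 1).indicator fun _ => K)
    ((integrable_indicator_iff measurableSet_Icc).2 (integrableOn_const (by simp)))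
    (fun x => Set.indicator_nonneg (fun _ _ => hK) x) ?_ ((Set.Ioc 0 τ).indicator h) ?_
  · rw [intervalIntegral.integral_of_le hτ0, ← integral_indicator measurableSet_Ioc]
    simpa using this
  · filter_upwards [hb, hr, hpos] with m h1 h2 h3 x j hj h4 h5
    have h3' : (0 : ℝ) < n m := Nat.cast_pos.2 h3
    rw [zero_add] at h4 h5
    rw [Set.indicator_of_mem]
    · exact h1 j hj
    · constructor
      · exact nonneg_of_mul_nonneg_right (le_trans (Nat.cast_nonneg j) h4) h3'
      · have : ((j + 1 : ℕ) : ℝ) ≤ n m := Nat.cast_le.2 (by omega)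
        push_cast at this
        nlinarith
  · have h0 : ∀ᵐ x : ℝ, x ∉ ({0, τ} : Set ℝ) :=
      (Set.toFinite ({0, τ} : Set ℝ)).countable.ae_notMem volume
    filter_upwards [h0] with x hx
    simp only [Set.mem_insert_iff, Set.mem_singleton_iff, not_or, zero_add] at hx ⊢
    rcases lt_or_gt_of_ne hx.1 with h | h
    · rw [Set.indicator_of_notMem (fun h' => absurd h'.1 (not_lt.2 h.le))]
      refine tendsto_const_nhds.congr' ?_
      filter_upwards [hpos] with m hm
      rw [if_neg]
      rintro ⟨h1, -⟩
      have : (0 : ℝ) < n m := Nat.cast_pos.2 hm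
      nlinarith
    · rcases lt_or_gt_of_ne hx.2 with h' | h'
      · rw [Set.indicator_of_mem (show x ∈ Set.Ioc 0 τ from ⟨h, h'.le⟩)]
        refine (hlim x h h').congr' ?_
        filter_upwards [hpos, hτ.eventually_const_lt h'] with m hm hm2
        have h3' : (0 : ℝ) < n m := Nat.cast_pos.2 hm
        rw [lt_div_iff₀ h3', mul_comm] at hm2
        rw [if_pos]
        have : 0 ≤ n m * x := by positivity
        exact ⟨this, (Nat.floor_lt this).2 hm2⟩
      · rw [Set.indicator_of_notMem (fun h2 => absurd h2.2 (not_le.2 h'))]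
        refine tendsto_const_nhds.congr' ?_
        filter_upwards [hpos, hτ.eventually_lt_const h'] with m hm hm2
        have h3' : (0 : ℝ) < n m := Nat.cast_pos.2 hm
        rw [div_lt_iff₀ h3', mul_comm] at hm2
        rw [if_neg]
        rintro ⟨-, h2⟩
        exact absurd h2 (not_lt.2 (Nat.le_floor hm2.le))

/-- The factor `e^{β/n} · 2 cos((2πl + α)/n)`. -/
noncomputable def dil (n : ℕ) (α β : ℂ) (l : ℕ) : ℂ :=
  Complex.exp (β / n) * (2 * Complex.cos ((2 * π * l + α) / n))

/-- The product of the first `r` factors `dil n α β l`, `1 ≤ l ≤ r`. -/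
noncomputable def dilProd (n : ℕ) (α β : ℂ) (r : ℕ) : ℂ :=
  ∏ l ∈ Finset.range r, dil n α β (l + 1)

theorem dil_approx_two (α β : ℂ) : ∃ C, 0 ≤ C ∧ ∀ n : ℕ, 0 < n → ∀ l : ℕ,
    ‖dil n α β l - (2 * (Real.cos (2 * π * (l / n)) : ℂ) + (2 * β * (Real.cos (2 * π * (l / n)) : ℂ)
      - 2 * α * (Real.sin (2 * π * (l / n)) : ℂ)) / n)‖ ≤ C / n ^ 2 := by
  set z := β + Complex.I * α with hz
  set w := β - Complex.I * α with hw
  refine ⟨‖z‖ ^ 2 * Real.exp ‖z‖ + ‖w‖ ^ 2 * Real.exp ‖w‖, by positivity, fun n hn l => ?_⟩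
  have hn' : (0 : ℝ) < n := Nat.cast_pos.2 hn
  have hn1 : (1 : ℝ) ≤ n := Nat.one_le_cast.2 hn
  have hnc : (n : ℂ) ≠ 0 := Nat.cast_ne_zero.2 hn.ne'
  have hexp : ∀ z : ℂ, ‖Complex.exp (z / n) - (1 + z / n)‖ ≤ ‖z‖ ^ 2 * Real.exp ‖z‖ / n ^ 2 := by
    intro z
    have := Complex.norm_exp_sub_sum_le_norm_mul_exp (z / n) 2
    simp only [Finset.sum_range_succ, Finset.sum_range_zero, norm_div, Complex.norm_natCast] at this
    simp only [pow_zero, Nat.factorial, Nat.cast_one, div_one, zero_add, pow_one, mul_one] at this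
    refine this.trans ?_
    rw [div_pow, div_mul_eq_mul_div]
    gcongr
    exact div_le_self (norm_nonneg _) hn1
  set θ : ℝ := 2 * π * (l / n) with hθ
  have e : dil n α β l - (2 * (Real.cos θ : ℂ) + (2 * β * (Real.cos θ : ℂ)
      - 2 * α * (Real.sin θ : ℂ)) / n) =
      Complex.exp (θ * Complex.I) * (Complex.exp (z / n) - (1 + z / n)) +
      Complex.exp (-θ * Complex.I) * (Complex.exp (w / n) - (1 + w / n)) := by
    have e1 : dil n α β l = Complex.exp (θ * Complex.I) * Complex.exp (z / n) +
        Complex.exp (-θ * Complex.I) * Complex.exp (w / n) := by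
      rw [dil, Complex.cos, mul_div_cancel₀ _ (two_ne_zero' ℂ), mul_add, ← Complex.exp_add,
        ← Complex.exp_add, ← Complex.exp_add, ← Complex.exp_add, hz, hw, hθ]
      push_cast
      congr 2 <;> ring
    rw [e1, Complex.ofReal_cos, Complex.ofReal_sin, Complex.cos, Complex.sin, hz, hw]
    ring
  rw [e]
  have n1 : ‖Complex.exp (θ * Complex.I)‖ = 1 := Complex.norm_exp_ofReal_mul_I θ
  have n2 : ‖Complex.exp (-θ * Complex.I)‖ = 1 := by
    simpa using Complex.norm_exp_ofReal_mul_I (-θ)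
  calc _ ≤ _ := norm_add_le _ _
    _ ≤ ‖z‖ ^ 2 * Real.exp ‖z‖ / n ^ 2 + ‖w‖ ^ 2 * Real.exp ‖w‖ / n ^ 2 := by
      rw [norm_mul, norm_mul, n1, n2, one_mul, one_mul]
      exact add_le_add (hexp z) (hexp w)
    _ = _ := by ring

theorem dil_approx (α β : ℂ) : ∃ C, 0 ≤ C ∧ ∀ n : ℕ, 0 < n → ∀ l : ℕ,
    ‖dil n α β l - 2 * (Real.cos (2 * π * (l / n)) : ℂ)‖ ≤ C / n := by
  obtain ⟨C, hC, h⟩ := dil_approx_two α β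
  refine ⟨C + (2 * ‖β‖ + 2 * ‖α‖), by positivity, fun n hn l => ?_⟩
  have hn1 : (1 : ℝ) ≤ n := Nat.one_le_cast.2 hn
  have h1 := h n hn l
  set c := Real.cos (2 * π * (l / n)) with hc
  set s := Real.sin (2 * π * (l / n)) with hs
  have hc1 : ‖(c : ℂ)‖ ≤ 1 := by
    rw [Complex.norm_real]; exact Real.abs_cos_le_one _
  have hs1 : ‖(s : ℂ)‖ ≤ 1 := by
    rw [Complex.norm_real]; exact Real.abs_sin_le_one _
  have h2 : ‖(2 * β * (c : ℂ) - 2 * α * (s : ℂ)) / n‖ ≤ (2 * ‖β‖ + 2 * ‖α‖) / n := by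
    rw [norm_div, Complex.norm_natCast]
    gcongr
    refine (norm_sub_le _ _).trans ?_
    simp only [norm_mul, Complex.norm_ofNat]
    nlinarith [norm_nonneg α, norm_nonneg β]
  have h3 : C / (n : ℝ) ^ 2 ≤ C / n := by
    gcongr
    nlinarith
  calc _ = ‖(dil n α β l - (2 * (c : ℂ) + (2 * β * (c : ℂ) - 2 * α * (s : ℂ)) / n)) +
        (2 * β * (c : ℂ) - 2 * α * (s : ℂ)) / n‖ := by congr 1; ring
    _ ≤ C / (n : ℝ) + (2 * ‖β‖ + 2 * ‖α‖) / n := (norm_add_le _ _).trans (add_le_add (h1.trans h3) h2)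
    _ = _ := by ring

/-- The relative perturbation of the factor `dil n α β (l + 1)`. -/
noncomputable def dilErr (n : ℕ) (α β : ℂ) (l : ℕ) : ℂ :=
  dil n α β (l + 1) / (2 * (Real.cos (2 * π * (((l + 1 : ℕ) : ℝ) / n)) : ℂ)) - 1

theorem one_fifth_le_cos_nat {n r l : ℕ} (hr : 5 * r ≤ n) (hl : l < r) :
    1 / 5 ≤ Real.cos (2 * π * (((l + 1 : ℕ) : ℝ) / n)) := by
  have hn : (0 : ℝ) < n := Nat.cast_pos.2 (by omega)
  refine one_fifth_le_cos (by positivity) ?_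
  rw [div_le_iff₀ hn]
  have : ((5 * (l + 1) : ℕ) : ℝ) ≤ n := Nat.cast_le.2 (by omega)
  push_cast at this ⊢
  linarith

theorem dilErr_approx (α β : ℂ) : ∃ C, 0 ≤ C ∧ ∀ n r : ℕ, 5 * r ≤ n → ∀ l < r,
    ‖dilErr n α β l‖ ≤ C / n ∧
    ‖dilErr n α β l - (β - α * (Real.tan (2 * π * (((l + 1 : ℕ) : ℝ) / n)) : ℂ)) / n‖
      ≤ C / n ^ 2 := by
  obtain ⟨C, hC, h⟩ := dil_approx α β
  obtain ⟨C', hC', h'⟩ := dil_approx_two α β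
  refine ⟨5 * C + 5 * C', by positivity, fun n r hr l hl => ?_⟩
  have hn : 0 < n := by omega
  have hnc : (n : ℂ) ≠ 0 := Nat.cast_ne_zero.2 hn.ne'
  have hcos := one_fifth_le_cos_nat hr hl
  have h1 := h n hn (l + 1)
  have h2 := h' n hn (l + 1)
  rw [dilErr, Real.tan_eq_sin_div_cos]
  set c := Real.cos (2 * π * (((l + 1 : ℕ) : ℝ) / n)) with hc
  set s := Real.sin (2 * π * (((l + 1 : ℕ) : ℝ) / n)) with hs
  have hc0 : (c : ℂ) ≠ 0 := Complex.ofReal_ne_zero.2 (by linarith)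
  have hinv : ‖(2 * (c : ℂ))⁻¹‖ ≤ 5 := by
    rw [norm_inv, norm_mul, Complex.norm_real, Complex.norm_ofNat, Real.norm_eq_abs,
      abs_of_pos (by linarith)]
    rw [inv_le_comm₀ (by linarith) (by norm_num)]
    linarith
  have hge : 0 ≤ C' / (n : ℝ) ^ 2 := by positivity
  have hge' : 0 ≤ C / (n : ℝ) := by positivity
  have hge1 : 0 ≤ C / (n : ℝ) ^ 2 := by positivity
  have hge1' : 0 ≤ C' / (n : ℝ) := by positivity
  constructor
  · calc _ = ‖(dil n α β (l + 1) - 2 * (c : ℂ)) * (2 * (c : ℂ))⁻¹‖ := by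
          congr 1; field_simp
      _ ≤ C / n * 5 := by rw [norm_mul]; gcongr
      _ ≤ _ := by rw [add_div, mul_div_assoc, mul_div_assoc]; linarith
  · calc _ = ‖(dil n α β (l + 1) - (2 * (c : ℂ) + (2 * β * (c : ℂ) - 2 * α * (s : ℂ)) / n))
          * (2 * (c : ℂ))⁻¹‖ := by
          congr 1; push_cast; field_simp; ring
      _ ≤ C' / n ^ 2 * 5 := by rw [norm_mul]; gcongr
      _ ≤ _ := by rw [add_div, mul_div_assoc, mul_div_assoc]; linarith

theorem dilProd_eq {n r : ℕ} (hr : 5 * r ≤ n) (α β : ℂ) :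
    dilProd n α β r = (Real.exp (∑ l ∈ Finset.range r, logCos (((l + 1 : ℕ) : ℝ) / n)) : ℂ) *
      ∏ l ∈ Finset.range r, (1 + dilErr n α β l) := by
  rw [Real.exp_sum, dilProd, Complex.ofReal_prod, ← Finset.prod_mul_distrib]
  refine Finset.prod_congr rfl fun l hl => ?_
  have hcos := one_fifth_le_cos_nat hr (Finset.mem_range.1 hl)
  rw [logCos, dilErr]
  rw [Real.exp_log (by linarith)]
  have hc0 : (Real.cos (2 * π * (((l + 1 : ℕ) : ℝ) / n)) : ℂ) ≠ 0 :=
    Complex.ofReal_ne_zero.2 (by linarith)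
  rw [Complex.ofReal_mul, Complex.ofReal_ofNat, add_sub_cancel,
    mul_div_cancel₀ _ (mul_ne_zero two_ne_zero hc0)]

theorem norm_dilProd_le (α β : ℂ) : ∃ C, 0 ≤ C ∧ ∀ n r : ℕ, 5 * r ≤ n → 0 < n →
    ‖dilProd n α β r‖ ≤ C * Real.exp (n * logCosInt (r / n)) := by
  obtain ⟨C, hC, h⟩ := dilErr_approx α β
  refine ⟨Real.exp (100 * π ^ 2 + C), by positivity, fun n r hr hn => ?_⟩
  have hn' : (0 : ℝ) < n := Nat.cast_pos.2 hn
  have hn1 : (1 : ℝ) ≤ n := Nat.one_le_cast.2 hn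
  have hrn : (5 : ℝ) * r ≤ n := by exact_mod_cast hr
  rw [dilProd_eq hr, norm_mul, Complex.norm_real, Real.norm_eq_abs, abs_of_pos (Real.exp_pos _)]
  have h1 : ‖∏ l ∈ Finset.range r, (1 + dilErr n α β l)‖ ≤ Real.exp C := by
    refine (norm_prod_one_add_le _ _).trans (Real.exp_le_exp.2 ?_)
    calc _ ≤ ∑ l ∈ Finset.range r, C / n :=
          Finset.sum_le_sum fun l hl => (h n r hr l (Finset.mem_range.1 hl)).1
      _ = r * C / n := by simp; ring
      _ ≤ C := by rw [div_le_iff₀ hn']; nlinarith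
  have h2 := (abs_le.1 (logCos_trapezoid hn hr)).2
  have h3 : 100 * π ^ 2 / n ≤ 100 * π ^ 2 := div_le_self (by positivity) hn1
  have h4 : logCos (r / n) ≤ logCos 0 := by
    have : 1 / 5 ≤ Real.cos (2 * π * (r / n)) :=
      one_fifth_le_cos (by positivity) (by rw [div_le_iff₀ hn']; linarith)
    unfold logCos
    refine Real.log_le_log (by linarith) ?_
    simpa using Real.cos_le_one (2 * π * (r / n))
  calc _ ≤ Real.exp (100 * π ^ 2 + n * logCosInt (r / n)) * Real.exp C := by
        gcongr; linarith
    _ = _ := by rw [← Real.exp_add, ← Real.exp_add]; ring_nf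

theorem integral_tan : ∫ t in (0 : ℝ)..(1 / 6), Real.tan (2 * π * t) = Real.log 2 / (2 * π) := by
  have h := intervalIntegral.integral_eq_sub_of_hasDerivAt (a := 0) (b := 1 / 6)
    (f := fun t => -(2 * π)⁻¹ * logCos t) (f' := fun t => Real.tan (2 * π * t)) ?_ ?_
  · rw [h, logCos_one_sixth, logCos]
    simp
    ring
  · intro x hx
    rw [Set.uIcc_of_le (by norm_num)] at hx
    have hc := one_fifth_le_cos hx.1 (hx.2.trans (by norm_num))
    refine ((hasDerivAt_logCos (by linarith)).const_mul (-(2 * π)⁻¹)).congr_deriv ?_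
    field_simp
  · refine ContinuousOn.intervalIntegrable fun x hx => ?_
    rw [Set.uIcc_of_le (by norm_num)] at hx
    have hc := one_fifth_le_cos hx.1 (hx.2.trans (by norm_num))
    exact ((Real.continuousAt_tan.2 (by linarith)).comp
      (f := fun t : ℝ => 2 * π * t) (by fun_prop)).continuousWithinAt

/-- The limiting constant in the asymptotics of `dilProd`. -/
noncomputable def dilConst (α β : ℂ) : ℂ :=
  Complex.exp (β / 6 - α * (Real.log 2 / (2 * π)) - Real.log 2 / 2)

theorem tendsto_dilProd (α β : ℂ) {r : ℕ → ℕ} (hr : ∀ᶠ n in atTop, 5 * r n ≤ n)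
    (hr6 : Tendsto (fun n => (r n : ℝ) / n) atTop (𝓝 (1 / 6))) :
    Tendsto (fun n : ℕ => dilProd n α β (r n) / (Real.exp (n * logCosInt (r n / n)) : ℂ)) atTop
      (𝓝 (dilConst α β)) := by
  obtain ⟨C, hC, h⟩ := dilErr_approx α β
  have hinv : Tendsto (fun n : ℕ => C / (n : ℝ)) atTop (𝓝 0) := tendsto_const_div_atTop_nhds_zero_nat C
  have htan : Tendsto (fun n : ℕ => (∑ l ∈ Finset.range (r n),
      (β - α * (Real.tan (2 * π * (((l + 1 : ℕ) : ℝ) / n)) : ℂ))) / (n : ℂ)) atTop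
      (𝓝 (∫ x in (0 : ℝ)..(1 / 6), (β - α * (Real.tan (2 * π * x) : ℂ)))) := by
    refine tendsto_riemann_sum (n := fun n => n) tendsto_id (hr.mono fun n hn => by omega)
      (by norm_num) hr6 (K := ‖β‖ + ‖α‖ * 5) (by positivity) ?_ ?_
    · filter_upwards [hr] with n hn l hl
      have hcos := one_fifth_le_cos_nat hn hl
      refine (norm_sub_le _ _).trans ?_
      rw [norm_mul, Complex.norm_real, Real.norm_eq_abs, Real.tan_eq_sin_div_cos, abs_div,
        abs_of_pos (a := Real.cos _) (by linarith)]
      gcongr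
      rw [div_le_iff₀ (by linarith)]
      linarith [Real.abs_sin_le_one (2 * π * (((l + 1 : ℕ) : ℝ) / n))]
    · intro x hx0 hx1
      have hc := one_fifth_le_cos hx0.le (hx1.le.trans (by norm_num))
      have hlim : Tendsto (fun n : ℕ => ((⌊(n : ℝ) * x⌋₊ + 1 : ℕ) : ℝ) / n) atTop (𝓝 x) := by
        have h1 : Tendsto (fun n : ℕ => (⌊x * (n : ℝ)⌋₊ : ℝ) / n) atTop (𝓝 x) :=
          (tendsto_nat_floor_mul_div_atTop hx0.le).comp tendsto_natCast_atTop_atTop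
        have h2 := h1.add (tendsto_const_div_atTop_nhds_zero_nat (1 : ℝ))
        rw [add_zero] at h2
        refine h2.congr fun n => ?_
        rw [mul_comm]
        push_cast
        ring
      have hct : ContinuousAt (fun t : ℝ => β - α * (Real.tan (2 * π * t) : ℂ)) x := by
        have : ContinuousAt (fun t : ℝ => Real.tan (2 * π * t)) x :=
          (Real.continuousAt_tan.2 (by linarith)).comp (f := fun t : ℝ => 2 * π * t) (by fun_prop)
        exact continuousAt_const.sub (continuousAt_const.mul
          (Complex.continuous_ofReal.continuousAt.comp this))
      exact hct.tendsto.comp hlim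
  have hI : ∫ x in (0 : ℝ)..(1 / 6), (β - α * (Real.tan (2 * π * x) : ℂ)) =
      β / 6 - α * (Real.log 2 / (2 * π)) := by
    rw [intervalIntegral.integral_sub (by simp), intervalIntegral.integral_const_mul,
      intervalIntegral.integral_ofReal, integral_tan]
    · simp
      ring
    · refine ContinuousOn.intervalIntegrable fun x hx => ?_
      rw [Set.uIcc_of_le (by norm_num)] at hx
      have hc := one_fifth_le_cos hx.1 (hx.2.trans (by norm_num))
      have : ContinuousAt (fun t : ℝ => Real.tan (2 * π * t)) x :=
        (Real.continuousAt_tan.2 (by linarith)).comp (f := fun t : ℝ => 2 * π * t) (by fun_prop)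
      exact (continuousAt_const.mul
        (Complex.continuous_ofReal.continuousAt.comp this)).continuousWithinAt
  have hsum : Tendsto (fun n : ℕ => ∑ l ∈ Finset.range (r n), dilErr n α β l) atTop
      (𝓝 (β / 6 - α * (Real.log 2 / (2 * π)))) := by
    rw [hI] at htan
    have hd : Tendsto (fun n : ℕ => ∑ l ∈ Finset.range (r n), (dilErr n α β l -
        (β - α * (Real.tan (2 * π * (((l + 1 : ℕ) : ℝ) / n)) : ℂ)) / n)) atTop (𝓝 0) := by
      refine squeeze_zero_norm' ?_ hinv
      filter_upwards [hr, eventually_gt_atTop 0] with n hn hn0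
      have hn' : (0 : ℝ) < n := Nat.cast_pos.2 hn0
      have hrn : (5 : ℝ) * r n ≤ n := by exact_mod_cast hn
      calc _ ≤ ∑ l ∈ Finset.range (r n), C / (n : ℝ) ^ 2 := (norm_sum_le _ _).trans
            (Finset.sum_le_sum fun l hl => (h n (r n) hn l (Finset.mem_range.1 hl)).2)
        _ = r n / n * (C / n) := by simp; field_simp
        _ ≤ 1 * (C / n) := by
          gcongr
          rw [div_le_one hn']
          have : (0 : ℝ) ≤ r n := Nat.cast_nonneg _
          linarith
        _ = C / n := one_mul _
    have := hd.add htan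
    rw [zero_add] at this
    refine this.congr fun n => ?_
    rw [Finset.sum_sub_distrib, ← Finset.sum_div]
    ring
  have hprod := tendsto_prod_one_add (F := atTop) (ε := fun n l => dilErr n α β l) (r := r)
    (δ := fun n : ℕ => C / (n : ℝ)) (C := C) (fun n => by positivity) hinv
    (by filter_upwards [hr] with n hn l hl using (h n (r n) hn l hl).1)
    (by
      filter_upwards [hr, eventually_gt_atTop 0] with n hn hn0
      have hn' : (0 : ℝ) < n := Nat.cast_pos.2 hn0
      have hrn : (5 : ℝ) * r n ≤ n := by exact_mod_cast hn
      have : (0 : ℝ) ≤ r n := Nat.cast_nonneg _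
      rw [mul_div_assoc', div_le_iff₀ hn']
      nlinarith) hsum
  have hreal : Tendsto (fun n : ℕ => ∑ l ∈ Finset.range (r n), logCos (((l + 1 : ℕ) : ℝ) / n)
      - n * logCosInt (r n / n)) atTop (𝓝 (-(Real.log 2 / 2))) := by
    have h1 : Tendsto (fun n : ℕ => ∑ l ∈ Finset.range (r n), logCos (((l + 1 : ℕ) : ℝ) / n)
        - n * logCosInt (r n / n) - (logCos (r n / n) - logCos 0) / 2) atTop (𝓝 0) := by
      refine squeeze_zero_norm' ?_ (tendsto_const_div_atTop_nhds_zero_nat (100 * π ^ 2))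
      filter_upwards [hr, eventually_gt_atTop 0] with n hn hn0
      exact logCos_trapezoid hn0 hn
    have hc6 : ContinuousAt logCos (1 / 6) := by
      have hc := one_fifth_le_cos (t := 1 / 6) (by norm_num) (by norm_num)
      exact (hasDerivAt_logCos (by linarith)).continuousAt
    have h2 := ((hc6.tendsto.comp hr6).sub_const (logCos 0)).div_const 2
    have h3 := h1.add h2
    have e : 0 + (logCos (1 / 6) - logCos 0) / 2 = -(Real.log 2 / 2) := by
      rw [logCos_one_sixth, logCos]
      simp
      ring
    rw [e] at h3
    refine h3.congr fun n => ?_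
    simp only [Function.comp]
    ring
  have hfin := ((Complex.continuous_ofReal.tendsto _).comp hreal).cexp.mul hprod
  have e : Complex.exp ((-(Real.log 2 / 2) : ℝ) : ℂ) *
      Complex.exp (β / 6 - α * (Real.log 2 / (2 * π))) = dilConst α β := by
    rw [dilConst, ← Complex.exp_add]
    congr 1
    push_cast
    ring
  rw [e] at hfin
  refine hfin.congr' ?_
  filter_upwards [hr] with n hn
  rw [dilProd_eq hn]
  simp only [Function.comp]
  rw [Complex.ofReal_sub, Complex.exp_sub, Complex.ofReal_exp, Complex.ofReal_exp]
  ring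

end Dil

section Laplace
open Topology MeasureTheory Real

theorem integral_gaussian_three : ∫ x : ℝ, Real.exp (-(π * √3) * x ^ 2) =
    (3 : ℝ) ^ (-(1 / 4 : ℝ)) := by
  rw [integral_gaussian, div_mul_eq_div_div, div_self Real.pi_ne_zero, Real.sqrt_eq_rpow,
    Real.sqrt_eq_rpow, one_div, ← Real.rpow_neg (by norm_num), ← Real.rpow_mul (by norm_num)]
  norm_num

/-- Laplace's method for sums modelled on `exp (n * logCosInt (r / n))`, normalised at the maximum
`r / n = 1 / 6`. -/
theorem tendsto_laplace (b : ℕ → ℕ → ℂ) {C : ℝ} (hC : 0 ≤ C)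
    (hb : ∀ᶠ n : ℕ in atTop, ∀ r : ℕ, 5 * r ≤ n →
      ‖b n r‖ ≤ C * Real.exp (n * (logCosInt (r / n) - logCosInt (1 / 6)))) (c : ℂ)
    (hlim : ∀ r : ℕ → ℕ, (∀ᶠ n in atTop, 5 * r n ≤ n) →
      Tendsto (fun n => (r n : ℝ) / n) atTop (𝓝 (1 / 6)) →
      Tendsto (fun n : ℕ => b n (r n) /
        (Real.exp (n * (logCosInt (r n / n) - logCosInt (1 / 6))) : ℂ)) atTop (𝓝 c)) :
    Tendsto (fun n : ℕ => (∑ r ∈ Finset.range (n / 5 + 1), b n r) / (√n : ℂ)) atTop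
      (𝓝 (c * ((3 : ℝ) ^ (-(1 / 4 : ℝ)) : ℝ))) := by
  have hgauss : ∫ x : ℝ, c * (Real.exp (-(π * √3) * x ^ 2) : ℂ) =
      c * ((3 : ℝ) ^ (-(1 / 4 : ℝ)) : ℝ) := by
    rw [integral_const_mul, integral_complex_ofReal, integral_gaussian_three]
  rw [← hgauss]
  refine tendsto_sum_div_of_dominated b (fun n => n / 5 + 1) (fun n : ℕ => (n : ℝ) / 6)
    (fun n : ℕ => √n) ?_ (fun x => C * Real.exp (1 / 2) * Real.exp (-(1 / 4) * x ^ 2)) ?_ ?_ ?_ _ ?_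
  · filter_upwards [eventually_gt_atTop 0] with n hn
    exact Real.sqrt_pos.2 (Nat.cast_pos.2 hn)
  · exact (integrable_exp_neg_mul_sq (by norm_num)).const_mul _
  · intro x
    positivity
  · filter_upwards [hb, eventually_gt_atTop 0] with n hn hn0 x r hr h1 h2
    have hn' : (0 : ℝ) < n := Nat.cast_pos.2 hn0
    have hn1 : (1 : ℝ) ≤ n := Nat.one_le_cast.2 hn0
    have hr5 : 5 * r ≤ n := by omega
    have hr5' : (5 : ℝ) * r ≤ n := by exact_mod_cast hr5
    refine (hn r hr5).trans ?_
    rw [mul_assoc, ← Real.exp_add]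
    refine mul_le_mul_of_nonneg_left (Real.exp_le_exp.2 ?_) hC
    have h3 := logCosInt_le (t := r / n) (by positivity) (by rw [div_le_iff₀ hn']; linarith)
    have h4 : n * (logCosInt (r / n) - logCosInt (1 / 6)) ≤ n * (-((r / n : ℝ) - 1 / 6) ^ 2 / 2) :=
      mul_le_mul_of_nonneg_left (by linarith) hn'.le
    refine h4.trans ?_
    have hs : √(n : ℝ) ^ 2 = n := Real.sq_sqrt hn'.le
    have e : (n : ℝ) * (-((r / n : ℝ) - 1 / 6) ^ 2 / 2) = -(r - n / 6) ^ 2 / (2 * n) := by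
      field_simp
    rw [e, div_le_iff₀ (by positivity)]
    set s := √(n : ℝ)
    obtain ⟨d, hd⟩ : ∃ d : ℝ, d = n / 6 + s * x - r := ⟨_, rfl⟩
    have hd0 : 0 ≤ d := by linarith
    have hd1 : d < 1 := by linarith
    have e2 : (r - n / 6 : ℝ) = s * x - d := by linarith
    rw [e2]
    nlinarith [sq_nonneg (s * x - 2 * d)]
  · refine Eventually.of_forall fun x => ?_
    set y : ℕ → ℝ := fun n => n / 6 + √n * x with hy
    have hsq : Tendsto (fun n : ℕ => (√(n : ℝ))⁻¹) atTop (𝓝 0) :=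
      (Real.tendsto_sqrt_atTop.comp tendsto_natCast_atTop_atTop).inv_tendsto_atTop
    have hyn : Tendsto (fun n => y n / n) atTop (𝓝 (1 / 6)) := by
      have := (hsq.mul_const x).const_add (1 / 6)
      rw [zero_mul, add_zero] at this
      refine this.congr' ?_
      filter_upwards [eventually_gt_atTop 0] with n hn
      have hn' : (0 : ℝ) < n := Nat.cast_pos.2 hn
      have hs := Real.sqrt_pos.2 hn'
      have hss : √(n : ℝ) ^ 2 = n := Real.sq_sqrt hn'.le
      rw [hy]
      field_simp
      linear_combination (-6 * x) * hss
    have hy0 : ∀ᶠ n : ℕ in atTop, 0 ≤ y n := by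
      filter_upwards [hyn.eventually_const_lt (show (0 : ℝ) < 1 / 6 by norm_num),
        eventually_gt_atTop 0] with n hn hn0
      have hn' : (0 : ℝ) < n := Nat.cast_pos.2 hn0
      exact ((div_pos_iff_of_pos_right hn').1 hn).le
    have hy5 : ∀ᶠ n : ℕ in atTop, 5 * ⌊y n⌋₊ ≤ n := by
      filter_upwards [hyn.eventually_lt_const (show (1 / 6 : ℝ) < 1 / 5 by norm_num),
        eventually_gt_atTop 0, hy0] with n hn hn0 hy0
      have hn' : (0 : ℝ) < n := Nat.cast_pos.2 hn0
      rw [div_lt_iff₀ hn'] at hn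
      have := Nat.floor_le hy0
      have h5 : (5 : ℝ) * ⌊y n⌋₊ ≤ n := by linarith
      exact_mod_cast h5
    have hxs : Tendsto (fun n : ℕ => √(n : ℝ) * ((⌊y n⌋₊ : ℝ) / n - 1 / 6)) atTop (𝓝 x) := by
      have h0 : Tendsto (fun n : ℕ => ((⌊y n⌋₊ : ℝ) - y n) * (√(n : ℝ))⁻¹) atTop (𝓝 0) := by
        refine squeeze_zero_norm' ?_ hsq
        filter_upwards [hy0] with n hn
        have h1 := Nat.floor_le hn
        have h2 := Nat.lt_floor_add_one (y n)
        rw [norm_mul, Real.norm_eq_abs, Real.norm_eq_abs, abs_of_nonneg (a := (√(n : ℝ))⁻¹) (by positivity)]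
        refine mul_le_of_le_one_left (by positivity) ?_
        rw [abs_le]
        constructor <;> linarith
      have := h0.add_const x
      rw [zero_add] at this
      refine this.congr' ?_
      filter_upwards [eventually_gt_atTop 0] with n hn
      have hn' : (0 : ℝ) < n := Nat.cast_pos.2 hn
      have hs := Real.sqrt_pos.2 hn'
      have hss : √(n : ℝ) ^ 2 = n := Real.sq_sqrt hn'.le
      rw [hy]
      field_simp
      rw [hss]
      ring
    have hr6 : Tendsto (fun n : ℕ => (⌊y n⌋₊ : ℝ) / n) atTop (𝓝 (1 / 6)) := by
      have := (hsq.mul hxs).const_add (1 / 6)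
      rw [zero_mul, add_zero] at this
      refine this.congr' ?_
      filter_upwards [eventually_gt_atTop 0] with n hn
      have hn' : (0 : ℝ) < n := Nat.cast_pos.2 hn
      have hs := Real.sqrt_pos.2 hn'
      rw [inv_mul_cancel_left₀ hs.ne']
      ring
    have h1 := hlim _ hy5 hr6
    have h2 := tendsto_logCosInt (n := fun n : ℕ => (n : ℝ))
      ((eventually_gt_atTop 0).mono fun n hn => Nat.cast_pos.2 hn) hr6 hxs
    have h3 := h1.mul ((Complex.continuous_ofReal.tendsto _).comp
      ((Real.continuous_exp.tendsto _).comp h2))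
    rw [neg_mul]
    refine h3.congr' ?_
    filter_upwards [hy0, hy5] with n hn0 hn5
    rw [if_pos ⟨hn0, show ⌊y n⌋₊ < n / 5 + 1 by omega⟩]
    simp only [Function.comp]
    rw [div_mul_cancel₀]
    exact Complex.ofReal_ne_zero.2 (Real.exp_pos _).ne'

/-- The main contribution: the sum of `dilProd` over the first fifth of the range. -/
theorem tendsto_sum_dilProd (α β : ℂ) :
    Tendsto (fun n : ℕ => (∑ r ∈ Finset.range (n / 5 + 1), dilProd n α β r) /
      ((√n * Real.exp (n * logCosInt (1 / 6)) : ℝ) : ℂ)) atTop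
      (𝓝 (dilConst α β * ((3 : ℝ) ^ (-(1 / 4 : ℝ)) : ℝ))) := by
  obtain ⟨C, hC, h⟩ := norm_dilProd_le α β
  have := tendsto_laplace (fun n r => dilProd n α β r / (Real.exp (n * logCosInt (1 / 6)) : ℂ)) hC
    ?_ (dilConst α β) ?_
  · refine this.congr fun n => ?_
    rw [← Finset.sum_div, div_div, mul_comm, Complex.ofReal_mul]
  · filter_upwards [eventually_gt_atTop 0] with n hn r hr
    rw [norm_div, Complex.norm_real, Real.norm_of_nonneg (Real.exp_pos _).le, mul_sub, Real.exp_sub,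
      mul_div_assoc']
    gcongr
    exact h n r hr hn
  · intro r hr hr6
    refine (tendsto_dilProd α β hr hr6).congr fun n => ?_
    rw [div_div, ← Complex.ofReal_mul, ← Real.exp_add]
    congr 3
    ring

/-- Consecutive products nearly cancel near the maximum. -/
theorem tendsto_sum_norm_dilProd_sub (α β : ℂ) :
    Tendsto (fun n : ℕ => (∑ r ∈ Finset.range (n / 5 + 1), ‖dilProd n α β r - dilProd n α β (r + 1)‖) /
      (√n * Real.exp (n * logCosInt (1 / 6)))) atTop (𝓝 0) := by
  obtain ⟨C, hC, h⟩ := norm_dilProd_le α β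
  obtain ⟨C', hC', h'⟩ := dil_approx α β
  have hfac : ∀ n r, ‖dilProd n α β r - dilProd n α β (r + 1)‖ =
      ‖dilProd n α β r‖ * ‖1 - dil n α β (r + 1)‖ := by
    intro n r
    rw [dilProd, dilProd, Finset.prod_range_succ, ← norm_mul, mul_one_sub]
  have := tendsto_laplace (fun n r => ((‖dilProd n α β r - dilProd n α β (r + 1)‖ /
    Real.exp (n * logCosInt (1 / 6)) : ℝ) : ℂ)) (C := C * (3 + C')) (by positivity) ?_ 0 ?_
  · rw [zero_mul] at this
    simp only [← Complex.ofReal_sum, ← Complex.ofReal_div] at this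
    rw [← Complex.ofReal_zero, Filter.tendsto_ofReal_iff] at this
    refine this.congr fun n => ?_
    rw [← Finset.sum_div, div_div, mul_comm]
  · filter_upwards [eventually_gt_atTop 0] with n hn r hr
    have hn1 : (1 : ℝ) ≤ n := Nat.one_le_cast.2 hn
    rw [Complex.norm_real, Real.norm_of_nonneg (by positivity), mul_sub, Real.exp_sub, hfac]
    have h1 : ‖1 - dil n α β (r + 1)‖ ≤ 3 + C' := by
      have h2 := h' n hn (r + 1)
      have h3 : C' / n ≤ C' := div_le_self hC' hn1
      set c := Real.cos (2 * π * (((r + 1 : ℕ) : ℝ) / n)) with hc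
      have hc1 : ‖(c : ℂ)‖ ≤ 1 := by
        rw [Complex.norm_real]; exact Real.abs_cos_le_one _
      calc ‖1 - dil n α β (r + 1)‖ = ‖1 - 2 * (c : ℂ) - (dil n α β (r + 1) - 2 * (c : ℂ))‖ := by
            congr 1; ring
        _ ≤ (1 + 2 * 1) + C' := by
          refine (norm_sub_le _ _).trans (add_le_add ((norm_sub_le _ _).trans ?_) (h2.trans h3))
          rw [norm_mul, norm_one, Complex.norm_ofNat]
          gcongr
        _ = _ := by ring
    calc _ ≤ C * Real.exp (n * logCosInt (r / n)) * (3 + C') / Real.exp (n * logCosInt (1 / 6)) := by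
          gcongr
          exact h n r hr hn
      _ = _ := by ring
  · intro r hr hr6
    have h1 := (tendsto_dilProd α β hr hr6).norm
    have h2 : Tendsto (fun n => ‖1 - dil n α β (r n + 1)‖) atTop (𝓝 0) := by
      have h3 : Tendsto (fun n : ℕ => ((r n + 1 : ℕ) : ℝ) / n) atTop (𝓝 (1 / 6)) := by
        have := hr6.add (tendsto_const_div_atTop_nhds_zero_nat (1 : ℝ))
        rw [add_zero] at this
        refine this.congr fun n => ?_
        push_cast
        ring
      have h4 : Tendsto (fun n : ℕ => 2 * (Real.cos (2 * π * (((r n + 1 : ℕ) : ℝ) / n)) : ℂ)) atTop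
          (𝓝 1) := by
        have hc : Continuous fun t : ℝ => 2 * (Real.cos (2 * π * t) : ℂ) := by fun_prop
        have := (hc.tendsto (1 / 6)).comp h3
        have e : 2 * (Real.cos (2 * π * (1 / 6)) : ℂ) = 1 := by
          rw [show 2 * π * (1 / 6) = π / 3 by ring, Real.cos_pi_div_three]
          push_cast
          norm_num
        rwa [e] at this
      have h5 : Tendsto (fun n : ℕ => dil n α β (r n + 1) -
          2 * (Real.cos (2 * π * (((r n + 1 : ℕ) : ℝ) / n)) : ℂ)) atTop (𝓝 0) := by
        refine squeeze_zero_norm' ?_ (tendsto_const_div_atTop_nhds_zero_nat C')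
        filter_upwards [eventually_gt_atTop 0] with n hn using h' n hn _
      have h6 := (h5.add h4).const_sub 1
      rw [zero_add, sub_self] at h6
      have := h6.norm
      rw [norm_zero] at this
      exact this.congr fun n => by rw [sub_add_cancel]
    have h3 := (Complex.continuous_ofReal.tendsto _).comp (h1.mul h2)
    rw [mul_zero, Complex.ofReal_zero] at h3
    refine h3.congr fun n => ?_
    simp only [Function.comp]
    rw [← Complex.ofReal_div, hfac, norm_div, Complex.norm_real,
      Real.norm_of_nonneg (Real.exp_pos _).le, mul_sub, Real.exp_sub]
    congr 1
    field_simp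

end Laplace

section Tail
open Topology MeasureTheory Real

theorem cos_two_pi_div_three : Real.cos (2 * π / 3) = -(1 / 2) := by
  rw [show 2 * π / 3 = π - π / 3 by ring, Real.cos_pi_sub, Real.cos_pi_div_three]

theorem abs_two_mul_cos_le_one {t : ℝ} (h0 : 1 / 6 ≤ t) (h1 : t ≤ 1 / 3) :
    |2 * Real.cos (2 * π * t)| ≤ 1 := by
  have hπ := Real.pi_pos
  have h2 : Real.cos (2 * π * t) ≤ Real.cos (π / 3) :=
    Real.cos_le_cos_of_nonneg_of_le_pi (by positivity) (by nlinarith) (by nlinarith)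
  have h3 : Real.cos (2 * π / 3) ≤ Real.cos (2 * π * t) :=
    Real.cos_le_cos_of_nonneg_of_le_pi (by nlinarith) (by nlinarith) (by nlinarith)
  rw [Real.cos_pi_div_three] at h2
  rw [cos_two_pi_div_three] at h3
  rw [abs_le]
  constructor <;> linarith

theorem one_le_abs_two_mul_cos {t : ℝ} (h0 : 1 / 3 ≤ t) (h1 : t ≤ 1 / 2) :
    1 ≤ |2 * Real.cos (2 * π * t)| := by
  have hπ := Real.pi_pos
  have h2 : Real.cos (2 * π * t) ≤ Real.cos (2 * π / 3) :=
    Real.cos_le_cos_of_nonneg_of_le_pi (by positivity) (by nlinarith) (by nlinarith)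
  rw [cos_two_pi_div_three] at h2
  rw [le_abs]
  right
  linarith

theorem norm_dilProd_succ (n : ℕ) (α β : ℂ) (r : ℕ) :
    ‖dilProd n α β (r + 1)‖ = ‖dilProd n α β r‖ * ‖dil n α β (r + 1)‖ := by
  rw [dilProd, dilProd, Finset.prod_range_succ, norm_mul]

theorem logCosInt_one_sixth_ge : 1 / 72 ≤ logCosInt (1 / 6) := by
  have := logCosInt_le (t := 0) le_rfl (by norm_num)
  have h0 : logCosInt 0 = 0 := by simp [logCosInt]
  rw [h0] at this
  linarith

theorem norm_dilProd_tail (α β : ℂ) {K : ℝ}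
    (hK : ∀ᶠ M : ℕ in atTop, ‖dilProd (2 * M + 1) α β M‖ ≤ K) :
    ∃ C, 0 ≤ C ∧ ∀ᶠ M : ℕ in atTop, ∀ r, (2 * M + 1) / 5 ≤ r → r ≤ M →
      ‖dilProd (2 * M + 1) α β r‖ ≤
        C * Real.exp ((2 * M + 1 : ℕ) * (logCosInt (1 / 6) - 1 / 7200)) := by
  obtain ⟨C₁, hC₁, h₁⟩ := norm_dilProd_le α β
  obtain ⟨C, hC, h⟩ := dil_approx α β
  have hK0 : 0 ≤ K := by
    obtain ⟨M, hM⟩ := hK.exists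
    exact (norm_nonneg _).trans hM
  refine ⟨C₁ * Real.exp C + K * Real.exp (2 * C), by positivity, ?_⟩
  filter_upwards [hK, eventually_ge_atTop 100, eventually_ge_atTop (⌈2 * C⌉₊)] with M hM hM1 hM2
  have hM3 : 2 * C ≤ M := Nat.ceil_le.1 hM2
  obtain ⟨n, hn⟩ : ∃ n, n = 2 * M + 1 := ⟨_, rfl⟩
  rw [← hn] at hM ⊢
  have hn0 : 0 < n := by omega
  have hn' : (0 : ℝ) < n := Nat.cast_pos.2 hn0
  have hnM : (n : ℝ) = 2 * M + 1 := by rw [hn]; push_cast; ring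
  have hn200 : (200 : ℝ) ≤ n := by exact_mod_cast (by omega : 200 ≤ n)
  have hL := logCosInt_one_sixth_ge
  have hup : ∀ r, 3 * r ≤ n → n / 5 ≤ r → ‖dilProd n α β r‖ ≤
      ‖dilProd n α β (n / 5)‖ * Real.exp (C / n) ^ (r - n / 5) := by
    intro r hr hr0
    induction r, hr0 using Nat.le_induction with
    | base => simp
    | succ r hr0 ih =>
      rw [norm_dilProd_succ, Nat.succ_sub hr0, pow_succ, ← mul_assoc]
      refine mul_le_mul (ih (by omega)) ?_ (norm_nonneg _) (by positivity)
      have h2 := h n hn0 (r + 1)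
      have h3 : |2 * Real.cos (2 * π * (((r + 1 : ℕ) : ℝ) / n))| ≤ 1 := by
        apply abs_two_mul_cos_le_one
        · rw [le_div_iff₀ hn']
          have : (n : ℝ) ≤ 6 * (r + 1 : ℕ) := by exact_mod_cast (by omega : n ≤ 6 * (r + 1))
          linarith
        · rw [div_le_iff₀ hn']
          have : (3 : ℝ) * (r + 1 : ℕ) ≤ n := by exact_mod_cast hr
          linarith
      have h4 : ‖2 * (Real.cos (2 * π * (((r + 1 : ℕ) : ℝ) / n)) : ℂ)‖ ≤ 1 := by
        rw [← Complex.ofReal_ofNat, ← Complex.ofReal_mul, Complex.norm_real]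
        exact h3
      have h5 := norm_sub_norm_le (dil n α β (r + 1))
        (2 * (Real.cos (2 * π * (((r + 1 : ℕ) : ℝ) / n)) : ℂ))
      have h6 := Real.add_one_le_exp (C / n)
      linarith
  have hdown : ∀ r, r ≤ M → n < 3 * (r + 1) →
      ‖dilProd n α β r‖ ≤ ‖dilProd n α β M‖ * Real.exp (2 * (C / n)) ^ (M - r) := by
    intro r hr
    induction hr using Nat.decreasingInduction with
    | self => intro _; simp
    | of_succ r hr ih =>
      intro hr0
      have ih := ih (by omega)
      rw [norm_dilProd_succ] at ih
      rw [show M - r = M - (r + 1) + 1 by omega, pow_succ, ← mul_assoc]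
      set X := ‖dilProd n α β M‖ * Real.exp (2 * (C / n)) ^ (M - (r + 1)) with hX
      have h2 := h n hn0 (r + 1)
      have h3 : 1 ≤ |2 * Real.cos (2 * π * (((r + 1 : ℕ) : ℝ) / n))| := by
        apply one_le_abs_two_mul_cos
        · rw [le_div_iff₀ hn']
          have : (n : ℝ) ≤ 3 * (r + 1 : ℕ) := by exact_mod_cast hr0.le
          linarith
        · rw [div_le_iff₀ hn']
          have : (2 : ℝ) * (r + 1 : ℕ) ≤ n := by exact_mod_cast (by omega : 2 * (r + 1) ≤ n)
          linarith
      have h4 : 1 ≤ ‖2 * (Real.cos (2 * π * (((r + 1 : ℕ) : ℝ) / n)) : ℂ)‖ := by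
        rw [← Complex.ofReal_ofNat, ← Complex.ofReal_mul, Complex.norm_real]
        exact h3
      have h5 := norm_sub_norm_le (2 * (Real.cos (2 * π * (((r + 1 : ℕ) : ℝ) / n)) : ℂ))
        (dil n α β (r + 1))
      rw [norm_sub_rev] at h5
      have h6 := Real.add_one_le_exp (2 * (C / n))
      have h7 : C / n ≤ 1 / 2 := by rw [div_le_iff₀ hn']; linarith
      have h8 : 0 ≤ C / n := by positivity
      have h9 : 1 - C / n ≤ ‖dil n α β (r + 1)‖ := by linarith
      have h10 : 1 ≤ (1 - C / n) * Real.exp (2 * (C / n)) := by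
        nlinarith
      have hd := norm_nonneg (dilProd n α β r)
      calc ‖dilProd n α β r‖ ≤ ‖dilProd n α β r‖ * ((1 - C / n) * Real.exp (2 * (C / n))) :=
            le_mul_of_one_le_right hd h10
        _ ≤ ‖dilProd n α β r‖ * (‖dil n α β (r + 1)‖ * Real.exp (2 * (C / n))) := by gcongr
        _ = ‖dilProd n α β r‖ * ‖dil n α β (r + 1)‖ * Real.exp (2 * (C / n)) := by ring
        _ ≤ X * Real.exp (2 * (C / n)) := by gcongr
  intro r hr0 hrM
  set E := Real.exp (n * (logCosInt (1 / 6) - 1 / 7200)) with hE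
  rw [add_mul]
  rcases le_or_gt (3 * r) n with hr | hr
  · refine (hup r hr hr0).trans (le_add_of_le_of_nonneg ?_ (by positivity))
    have h5 : 5 * (n / 5) ≤ n := by omega
    have h6 := h₁ n (n / 5) h5 hn0
    have h5' : (5 : ℝ) * (n / 5 : ℕ) ≤ n := by exact_mod_cast h5
    have h5'' : (n : ℝ) ≤ 5 * (n / 5 : ℕ) + 5 := by exact_mod_cast (by omega : n ≤ 5 * (n / 5) + 5)
    have h7 := logCosInt_le (t := (n / 5 : ℕ) / n) (by positivity)
      (by rw [div_le_iff₀ hn']; linarith)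
    have h8 : (11 / 60 : ℝ) ≤ (n / 5 : ℕ) / n := by
      rw [le_div_iff₀ hn']; linarith
    have h9 : Real.exp (n * logCosInt ((n / 5 : ℕ) / n)) ≤ E := by
      refine Real.exp_le_exp.2 (mul_le_mul_of_nonneg_left ?_ hn'.le)
      nlinarith
    have h10 : Real.exp (C / n) ^ (r - n / 5) ≤ Real.exp C := by
      rw [← Real.exp_nat_mul]
      refine Real.exp_le_exp.2 ?_
      have : ((r - n / 5 : ℕ) : ℝ) ≤ n := by exact_mod_cast (by omega : r - n / 5 ≤ n)
      calc _ ≤ n * (C / n) := by gcongr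
        _ = C := by field_simp
    calc _ ≤ (C₁ * E) * Real.exp C := by
          gcongr
          exact h6.trans (by gcongr)
      _ = _ := by ring
  · refine (hdown r hrM (by omega)).trans (le_add_of_nonneg_of_le (by positivity) ?_)
    have h9 : 1 ≤ E := Real.one_le_exp (mul_nonneg hn'.le (by linarith))
    have h10 : Real.exp (2 * (C / n)) ^ (M - r) ≤ Real.exp (2 * C) := by
      rw [← Real.exp_nat_mul]
      refine Real.exp_le_exp.2 ?_
      have : ((M - r : ℕ) : ℝ) ≤ n := by exact_mod_cast (by omega : M - r ≤ n)
      calc _ ≤ n * (2 * (C / n)) := by gcongr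
        _ = 2 * C := by field_simp
    calc _ ≤ K * Real.exp (2 * C) := by gcongr
      _ ≤ _ := le_mul_of_one_le_right (by positivity) h9

/-- The size of the sums of `dilProd`. -/
noncomputable def lapScale (n : ℕ) : ℝ := √n * Real.exp (n * logCosInt (1 / 6))

theorem tendsto_two_mul_add_one : Tendsto (fun M : ℕ => 2 * M + 1) atTop atTop :=
  tendsto_atTop_mono (fun M => by simp only [id]; omega) tendsto_id

theorem tendsto_tail_div_lapScale (C : ℝ) (hC : 0 ≤ C) : Tendsto (fun n : ℕ =>
    n * (C * Real.exp (n * (logCosInt (1 / 6) - 1 / 7200))) / lapScale n) atTop (𝓝 0) := by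
  have h := (Real.tendsto_pow_mul_exp_neg_atTop_nhds_zero 1).comp
    ((tendsto_natCast_atTop_atTop (R := ℝ)).atTop_mul_const (r := 1 / 7200) (by norm_num))
  have h1 := h.const_mul (C * 7200)
  rw [mul_zero] at h1
  refine squeeze_zero' (Eventually.of_forall fun n => ?_) ?_ h1
  · rw [lapScale]; positivity
  · filter_upwards [eventually_gt_atTop 0] with n hn
    have hn1 : (1 : ℝ) ≤ n := Nat.one_le_cast.2 hn
    have hs : 1 ≤ √(n : ℝ) := Real.one_le_sqrt.2 hn1
    simp only [Function.comp, pow_one, lapScale]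
    rw [mul_sub, sub_eq_add_neg, Real.exp_add]
    rw [div_le_iff₀ (by positivity)]
    calc _ = (C * 7200 * (n * (1 / 7200) * Real.exp (-(n * (1 / 7200))))) * (1 * Real.exp (n * logCosInt (1 / 6))) := by
          ring
      _ ≤ _ := by gcongr

theorem tendsto_one_div_lapScale : Tendsto (fun n : ℕ => 1 / lapScale n) atTop (𝓝 0) := by
  have h := tendsto_tail_div_lapScale 1 zero_le_one
  refine squeeze_zero' (Eventually.of_forall fun n => ?_) ?_ h
  · rw [lapScale]; positivity
  · filter_upwards [eventually_gt_atTop 0] with n hn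
    have hn1 : (1 : ℝ) ≤ n := Nat.one_le_cast.2 hn
    have hL := logCosInt_one_sixth_ge
    have h9 : 1 ≤ Real.exp (n * (logCosInt (1 / 6) - 1 / 7200)) :=
      Real.one_le_exp (mul_nonneg (by linarith) (by linarith))
    have hl : 0 ≤ lapScale n := by rw [lapScale]; positivity
    gcongr
    nlinarith

/-- Sum over the half period, with any weights of modulus at most one: the part beyond one fifth of
the period is negligible. -/
theorem tendsto_sum_tail (α β : ℂ) {K : ℝ}
    (hK : ∀ᶠ M : ℕ in atTop, ‖dilProd (2 * M + 1) α β M‖ ≤ K) {w : ℕ → ℂ} (hw : ∀ j, ‖w j‖ ≤ 1) :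
    Tendsto (fun M : ℕ => (∑ r ∈ Finset.Ico ((2 * M + 1) / 5 + 1) (M + 1),
      w r * dilProd (2 * M + 1) α β r) / (lapScale (2 * M + 1) : ℂ)) atTop (𝓝 0) := by
  obtain ⟨C, hC, h⟩ := norm_dilProd_tail α β hK
  refine squeeze_zero_norm' ?_ ((tendsto_tail_div_lapScale C hC).comp tendsto_two_mul_add_one)
  filter_upwards [h] with M hM
  simp only [Function.comp]
  have hl : 0 ≤ lapScale (2 * M + 1) := by rw [lapScale]; positivity
  rw [norm_div, Complex.norm_real, Real.norm_of_nonneg hl]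
  gcongr
  calc _ ≤ ∑ r ∈ Finset.Ico ((2 * M + 1) / 5 + 1) (M + 1),
        C * Real.exp ((2 * M + 1 : ℕ) * (logCosInt (1 / 6) - 1 / 7200)) := by
        refine norm_sum_le_of_le _ fun r hr => ?_
        rw [Finset.mem_Ico] at hr
        rw [norm_mul]
        exact (mul_le_of_le_one_left (norm_nonneg _) (hw r)).trans (hM r (by omega) (by omega))
    _ ≤ _ := by
      rw [Finset.sum_const, nsmul_eq_mul, Nat.card_Ico]
      gcongr
      omega

theorem sum_range_half (M : ℕ) (hM : 2 ≤ M) (f : ℕ → ℂ) : ∑ r ∈ Finset.range (M + 1), f r =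
    ∑ r ∈ Finset.range ((2 * M + 1) / 5 + 1), f r +
      ∑ r ∈ Finset.Ico ((2 * M + 1) / 5 + 1) (M + 1), f r :=
  (Finset.sum_range_add_sum_Ico f (by omega)).symm

theorem tendsto_sum_half (α β : ℂ) {K : ℝ}
    (hK : ∀ᶠ M : ℕ in atTop, ‖dilProd (2 * M + 1) α β M‖ ≤ K) :
    Tendsto (fun M : ℕ => (∑ r ∈ Finset.range (M + 1), dilProd (2 * M + 1) α β r) /
      (lapScale (2 * M + 1) : ℂ)) atTop (𝓝 (dilConst α β * ((3 : ℝ) ^ (-(1 / 4 : ℝ)) : ℝ))) := by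
  have h1 := (tendsto_sum_dilProd α β).comp tendsto_two_mul_add_one
  have h2 := tendsto_sum_tail α β hK (w := fun _ => 1) (by simp)
  have := h1.add h2
  rw [add_zero] at this
  refine this.congr' ?_
  filter_upwards [eventually_ge_atTop 2] with M hM
  rw [sum_range_half M hM, add_div]
  simp [Function.comp, lapScale]

theorem two_mul_sum_alternating (B : ℕ → ℂ) (N : ℕ) :
    2 * ∑ j ∈ Finset.range N, (-1) ^ j * B j =
      ∑ j ∈ Finset.range N, (-1) ^ j * (B j - B (j + 1)) + B 0 - (-1) ^ N * B N := by
  induction N with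
  | zero => simp
  | succ N ih =>
    rw [Finset.sum_range_succ, Finset.sum_range_succ, mul_add, ih]
    ring

theorem tendsto_sum_half_alternating (α β : ℂ) {K : ℝ}
    (hK : ∀ᶠ M : ℕ in atTop, ‖dilProd (2 * M + 1) α β M‖ ≤ K) :
    Tendsto (fun M : ℕ => (∑ r ∈ Finset.range (M + 1), (-1) ^ r * dilProd (2 * M + 1) α β r) /
      (lapScale (2 * M + 1) : ℂ)) atTop (𝓝 0) := by
  have h2 := tendsto_sum_tail α β hK (w := fun j => (-1) ^ j) (by simp)
  obtain ⟨C, hC, h⟩ := norm_dilProd_tail α β hK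
  have h1 : Tendsto (fun M : ℕ => (∑ r ∈ Finset.range ((2 * M + 1) / 5 + 1),
      (-1) ^ r * dilProd (2 * M + 1) α β r) / (lapScale (2 * M + 1) : ℂ)) atTop (𝓝 0) := by
    have hb := (((tendsto_sum_norm_dilProd_sub α β).add tendsto_one_div_lapScale).add
      (tendsto_tail_div_lapScale C hC)).comp tendsto_two_mul_add_one
    rw [add_zero, add_zero] at hb
    refine squeeze_zero_norm' ?_ hb
    filter_upwards [h, eventually_ge_atTop 2] with M hM hM2
    simp only [Function.comp]
    obtain ⟨n, hn⟩ : ∃ n, n = 2 * M + 1 := ⟨_, rfl⟩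
    rw [← hn] at hM ⊢
    have hl : 0 ≤ lapScale n := by rw [lapScale]; positivity
    have hn1 : (1 : ℝ) ≤ n := Nat.one_le_cast.2 (by omega)
    rw [norm_div, Complex.norm_real, Real.norm_of_nonneg hl, ← lapScale, ← add_div, ← add_div]
    gcongr
    have e := two_mul_sum_alternating (dilProd n α β) (n / 5 + 1)
    have h3 := hM (n / 5 + 1) (by omega) (by omega)
    set S := ∑ r ∈ Finset.range (n / 5 + 1), (-1) ^ r * dilProd n α β r
    have h4 : ‖S‖ ≤ ‖2 * S‖ := by
      rw [norm_mul, Complex.norm_ofNat]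
      linarith [norm_nonneg S]
    refine h4.trans ?_
    rw [e]
    refine (norm_sub_le _ _).trans (add_le_add ((norm_add_le _ _).trans (add_le_add ?_ ?_)) ?_)
    · refine norm_sum_le_of_le _ fun r _ => ?_
      simp
    · simp [dilProd]
    · rw [norm_mul, norm_pow, norm_neg, norm_one, one_pow, one_mul]
      refine h3.trans (le_mul_of_one_le_left (by positivity) hn1)
  have := h1.add h2
  rw [add_zero] at this
  refine this.congr' ?_
  filter_upwards [eventually_ge_atTop 2] with M hM
  rw [sum_range_half M hM, add_div]

end Tail

section HalfPeriod
open Topology MeasureTheory Real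

theorem integral_cos_div_sinc : ∫ x in (0 : ℝ)..(π / 2), Real.cos x / Real.sinc x =
    Real.log 2 * π / 2 := by
  have hπ := Real.pi_pos
  have hs : ∀ x ∈ Set.Icc 0 (π / 2), Real.sinc x ≠ 0 := by
    intro x hx
    rcases eq_or_lt_of_le hx.1 with rfl | h
    · simp
    · rw [Real.sinc_of_ne_zero h.ne']
      exact (div_pos (Real.sin_pos_of_pos_of_lt_pi h (by linarith [hx.2])) h).ne'
  have hc : ContinuousOn (fun x => Real.cos x / Real.sinc x) (Set.Icc 0 (π / 2)) :=
    Real.continuous_cos.continuousOn.div Real.continuous_sinc.continuousOn hs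
  have hci : IntervalIntegrable (fun x => Real.cos x / Real.sinc x) volume 0 (π / 2) := by
    apply ContinuousOn.intervalIntegrable
    rwa [Set.uIcc_of_le (by positivity)]
  have hli : IntervalIntegrable (fun x => Real.log (Real.sin x)) volume 0 (π / 2) :=
    intervalIntegrable_log_sin
  have h := intervalIntegral.integral_eq_sub_of_hasDerivAt_of_le (a := 0) (b := π / 2)
    (f := fun x => Real.sin x * Real.log (Real.sin x) / Real.sinc x)
    (f' := fun x => Real.log (Real.sin x) + Real.cos x / Real.sinc x) (by positivity)
    ((Real.continuous_sin.mul_log).continuousOn.div Real.continuous_sinc.continuousOn hs) ?_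
    (hli.add hci)
  · rw [intervalIntegral.integral_add hli hci, integral_log_sin_zero_pi_div_two] at h
    simp at h
    linarith
  · intro x hx
    have hsin := Real.sin_pos_of_pos_of_lt_pi hx.1 (by linarith [hx.2])
    have h1 : HasDerivAt (fun x => x * Real.log (Real.sin x))
        (1 * Real.log (Real.sin x) + x * (Real.cos x / Real.sin x)) x :=
      (hasDerivAt_id x).mul ((Real.hasDerivAt_sin x).log hsin.ne')
    have h2 : (fun x => Real.sin x * Real.log (Real.sin x) / Real.sinc x) =ᶠ[𝓝 x]
        fun x => x * Real.log (Real.sin x) := by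
      filter_upwards [eventually_ne_nhds hx.1.ne',
        Real.continuous_sin.continuousAt.eventually_ne hsin.ne'] with y hy hy'
      rw [Real.sinc_of_ne_zero hy]
      field_simp
    refine (h1.congr_of_eventuallyEq h2).congr_deriv ?_
    have := hx.1.ne'
    rw [Real.sinc_of_ne_zero this]
    field_simp

theorem integral_cos_div_sinc_symm : ∫ x in (-(π / 2))..(π / 2), Real.cos x / Real.sinc x =
    Real.log 2 * π := by
  have hs : ∀ x ∈ Set.Icc (-(π / 2)) (π / 2), Real.sinc x ≠ 0 := by
    intro x hx
    have hπ := Real.pi_pos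
    rcases lt_trichotomy x 0 with h | rfl | h
    · rw [Real.sinc_of_ne_zero h.ne]
      exact (div_pos_of_neg_of_neg (Real.sin_neg_of_neg_of_neg_pi_lt h (by linarith [hx.1])) h).ne'
    · simp
    · rw [Real.sinc_of_ne_zero h.ne']
      exact (div_pos (Real.sin_pos_of_pos_of_lt_pi h (by linarith [hx.2])) h).ne'
  have hc : ContinuousOn (fun x => Real.cos x / Real.sinc x) (Set.Icc (-(π / 2)) (π / 2)) :=
    Real.continuous_cos.continuousOn.div Real.continuous_sinc.continuousOn hs
  have hπ := Real.pi_pos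
  have h1 : IntervalIntegrable (fun x => Real.cos x / Real.sinc x) volume (-(π / 2)) 0 := by
    apply ContinuousOn.intervalIntegrable
    rw [Set.uIcc_of_le (by linarith)]
    exact hc.mono (Set.Icc_subset_Icc_right (by linarith))
  have h2 : IntervalIntegrable (fun x => Real.cos x / Real.sinc x) volume 0 (π / 2) := by
    apply ContinuousOn.intervalIntegrable
    rw [Set.uIcc_of_le (by linarith)]
    exact hc.mono (Set.Icc_subset_Icc_left (by linarith))
  have h3 : ∫ x in (-(π / 2))..0, Real.cos x / Real.sinc x =
      ∫ x in (0 : ℝ)..(π / 2), Real.cos x / Real.sinc x := by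
    have := intervalIntegral.integral_comp_neg (a := 0) (b := π / 2)
      (fun x => Real.cos x / Real.sinc x)
    simp only [Real.cos_neg, Real.sinc_neg, neg_zero] at this
    exact this.symm
  rw [← intervalIntegral.integral_add_adjacent_intervals h1 h2, h3, integral_cos_div_sinc]
  ring

/-- The entire function `sin z / z`. -/
noncomputable def csinc : ℂ → ℂ := dslope Complex.sin 0

theorem continuous_csinc : Continuous csinc := by
  rw [← continuousOn_univ, csinc, continuousOn_dslope univ_mem]
  exact ⟨Complex.continuous_sin.continuousOn, Complex.differentiable_sin 0⟩

theorem csinc_zero : csinc 0 = 1 := by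
  rw [csinc, dslope_same, Complex.deriv_sin, Complex.cos_zero]

theorem mul_csinc (z : ℂ) : z * csinc z = Complex.sin z := by
  have := sub_smul_dslope Complex.sin 0 z
  simpa [csinc] using this

theorem csinc_ofReal (x : ℝ) : csinc x = (Real.sinc x : ℂ) := by
  by_cases hx : x = 0
  · simp [hx, csinc_zero]
  · have hx' : (x : ℂ) ≠ 0 := Complex.ofReal_ne_zero.2 hx
    rw [Real.sinc_of_ne_zero hx, Complex.ofReal_div, Complex.ofReal_sin, eq_div_iff hx', mul_comm,
      mul_csinc]

theorem csinc_ne_zero {z : ℂ} (hz : |z.re| ≤ 2) : csinc z ≠ 0 := by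
  intro h
  have hs : Complex.sin z = 0 := by rw [← mul_csinc, h, mul_zero]
  obtain ⟨k, rfl⟩ := Complex.sin_eq_zero_iff.1 hs
  have hre : ((k : ℂ) * π).re = k * π := by simp
  rw [hre, abs_mul, abs_of_pos Real.pi_pos] at hz
  have hπ := Real.pi_gt_three
  have h1 : |(k : ℝ)| < 1 := by nlinarith [abs_nonneg (k : ℝ)]
  have h2 : |k| < 1 := by exact_mod_cast h1
  rw [Int.abs_lt_one_iff.1 h2] at h
  simp [csinc_zero] at h

theorem continuousAt_cos_div_csinc {z : ℂ} (hz : |z.re| ≤ 2) :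
    ContinuousAt (fun z => Complex.cos z / csinc z) z :=
  Complex.continuous_cos.continuousAt.div continuous_csinc.continuousAt (csinc_ne_zero hz)

theorem exists_bound_cos_div_csinc : ∃ B, 0 ≤ B ∧ ∀ z : ℂ, |z.re| ≤ 2 → |z.im| ≤ 1 →
    ‖Complex.cos z / csinc z‖ ≤ B := by
  have hK : IsCompact (Set.Icc (-2 : ℝ) 2 ×ℂ Set.Icc (-1 : ℝ) 1) := isCompact_Icc.reProdIm isCompact_Icc
  obtain ⟨B, hB⟩ := hK.exists_bound_of_continuousOn (f := fun z => Complex.cos z / csinc z)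
    fun z hz => (continuousAt_cos_div_csinc (abs_le.2 (Complex.mem_reProdIm.1 hz).1)).continuousWithinAt
  exact ⟨max B 0, le_max_right _ _, fun z h1 h2 =>
    (hB z (Complex.mem_reProdIm.2 ⟨abs_le.1 h1, abs_le.1 h2⟩)).trans (le_max_left _ _)⟩

/-- The scaled relative change of `sin y` when `y` is replaced by `(1 - 1/n) y`. -/
noncomputable def sinShift (n : ℂ) (y : ℂ) : ℂ :=
  -(y ^ 2 / (2 * n)) * csinc (y / (2 * n)) ^ 2 - Complex.cos y / csinc y * csinc (y / n)

theorem sin_shift {n y : ℂ} (hn : n ≠ 0) (hy : |y.re| ≤ 2) :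
    Complex.sin ((1 - 1 / n) * y) = Complex.sin y * (1 + sinShift n y / n) := by
  have hcs := csinc_ne_zero hy
  have h1 : (1 - 1 / n) * y = y - y / n := by field_simp
  have h2 : Complex.cos (y / n) = 1 - 2 * Complex.sin (y / (2 * n)) ^ 2 := by
    have : y / n = 2 * (y / (2 * n)) := by field_simp
    rw [this, Complex.cos_two_mul, Complex.cos_sq']
    ring
  rw [h1, Complex.sin_sub, h2, ← mul_csinc y, ← mul_csinc (y / n), ← mul_csinc (y / (2 * n)), sinShift]
  field_simp
  ring

theorem half_product_eq {M : ℕ} (hM : 0 < M) (α β : ℂ) : (-1) ^ M * dilProd (2 * M + 1) α β M =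
    Complex.exp (β * M / (2 * M + 1)) * ∏ l ∈ Finset.range M, (2 * Complex.sin
      ((1 - 1 / ((2 * M + 1 : ℕ) : ℂ)) * ((π * (l + 1) + α / 2 - π * (2 * M + 1) / 4) / M))) := by
  have hMc : (M : ℂ) ≠ 0 := Nat.cast_ne_zero.2 hM.ne'
  have hnc : (2 * M + 1 : ℂ) ≠ 0 := by exact_mod_cast (by omega : 2 * M + 1 ≠ 0)
  have h1 : (-1 : ℂ) ^ M = ∏ l ∈ Finset.range M, (-1 : ℂ) := by simp
  have h2 : Complex.exp (β * M / (2 * M + 1)) =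
      ∏ l ∈ Finset.range M, Complex.exp (β / (2 * M + 1)) := by
    rw [Finset.prod_const, Finset.card_range, ← Complex.exp_nat_mul]
    congr 1
    ring
  rw [h1, h2, dilProd, ← Finset.prod_mul_distrib, ← Finset.prod_mul_distrib]
  refine Finset.prod_congr rfl fun l _ => ?_
  have e : (1 - 1 / ((2 * M + 1 : ℕ) : ℂ)) * ((π * (l + 1) + α / 2 - π * (2 * M + 1) / 4) / M) =
      (2 * π * ((l + 1 : ℕ) : ℂ) + α) / ((2 * M + 1 : ℕ) : ℂ) - π / 2 := by
    push_cast
    field_simp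
    ring
  rw [dil, e, Complex.sin_sub_pi_div_two]
  push_cast
  ring

theorem prod_two_mul_sin_half {M : ℕ} (hM : 0 < M) (α : ℂ) : ∏ l ∈ Finset.range M, (2 * Complex.sin
      ((π * (l + 1) + α / 2 - π * (2 * M + 1) / 4) / M)) =
    2 * Complex.sin (π * (2 * M + 1) / 4 - α / 2) := by
  have := prod_two_mul_sin M hM (π - (π * (2 * M + 1) / 4 - α / 2))
  rw [Complex.sin_pi_sub] at this
  rw [← this]
  refine Finset.prod_congr rfl fun l _ => ?_
  congr 2
  ring

end HalfPeriod

section HalfPeriodLimit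
open Topology MeasureTheory Real

/-- The rescaled sample points in the half-period product. -/
noncomputable def halfNode (α : ℂ) (M l : ℕ) : ℂ :=
  (π * (l + 1) + α / 2 - π * (2 * M + 1) / 4) / M

theorem halfNode_bounds (α : ℂ) : ∀ᶠ M : ℕ in atTop, ∀ l < M,
    |(halfNode α M l).re| ≤ 2 ∧ |(halfNode α M l).im| ≤ 1 := by
  filter_upwards [eventually_ge_atTop ⌈10 * (‖α‖ + 1)⌉₊] with M hM l hl
  have hM' : 10 * (‖α‖ + 1) ≤ M := Nat.ceil_le.1 hM
  have hα := norm_nonneg α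
  have hM0 : (0 : ℝ) < M := by linarith
  have hlM : (l : ℝ) + 1 ≤ M := by exact_mod_cast hl
  have hl0 : (0 : ℝ) ≤ l := Nat.cast_nonneg l
  have hπ := Real.pi_pos
  have hπ2 := Real.pi_lt_d2
  have hre := abs_le.1 (Complex.abs_re_le_norm α)
  have him := abs_le.1 (Complex.abs_im_le_norm α)
  have e : halfNode α M l = (((π * (l + 1) + α.re / 2 - π * (2 * M + 1) / 4) / M : ℝ) : ℂ) +
      ((α.im / 2 / M : ℝ) : ℂ) * Complex.I := by
    rw [halfNode]
    nth_rewrite 1 [← Complex.re_add_im α]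
    push_cast
    ring
  rw [e, Complex.add_re, Complex.add_im, Complex.re_ofReal_mul, Complex.im_ofReal_mul]
  simp only [Complex.ofReal_re, Complex.ofReal_im, Complex.I_re, Complex.I_im, mul_zero, add_zero,
    zero_add, mul_one]
  rw [abs_le, abs_le]
  refine ⟨⟨?_, ?_⟩, ⟨?_, ?_⟩⟩
  · rw [le_div_iff₀ hM0]; nlinarith
  · rw [div_le_iff₀ hM0]; nlinarith
  · rw [le_div_iff₀ hM0]; nlinarith
  · rw [div_le_iff₀ hM0]; nlinarith

theorem norm_sinShift_le : ∃ B, 0 ≤ B ∧ ∀ (n : ℕ) (y : ℂ), 0 < n → |y.re| ≤ 2 → |y.im| ≤ 1 →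
    ‖sinShift n y‖ ≤ B := by
  obtain ⟨B₁, hB₁, h₁⟩ := exists_bound_cos_div_csinc
  obtain ⟨B₂, h₂⟩ := (isCompact_closedBall (0 : ℂ) 3).exists_bound_of_continuousOn
    continuous_csinc.continuousOn
  have hB₂ : 0 ≤ B₂ := (norm_nonneg _).trans (h₂ 0 (by simp))
  refine ⟨9 * B₂ ^ 2 + B₁ * B₂, by positivity, fun n y hn h3 h4 => ?_⟩
  have hn1 : (1 : ℝ) ≤ n := Nat.one_le_cast.2 hn
  have hy : ‖y‖ ≤ 3 := (Complex.norm_le_abs_re_add_abs_im y).trans (by linarith)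
  have h5 : ‖y / n‖ ≤ 3 := by
    rw [norm_div, Complex.norm_natCast]
    exact (div_le_self (norm_nonneg _) hn1).trans hy
  have h6 : ‖y / (2 * n)‖ ≤ 3 := by
    rw [norm_div, norm_mul, Complex.norm_natCast, Complex.norm_ofNat]
    exact (div_le_self (norm_nonneg _) (by linarith)).trans hy
  have h7 : ‖y ^ 2 / (2 * n : ℂ)‖ ≤ 9 := by
    rw [norm_div, norm_mul, Complex.norm_natCast, Complex.norm_ofNat, norm_pow]
    refine (div_le_self (by positivity) (by linarith)).trans ?_
    nlinarith [norm_nonneg y]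
  rw [sinShift]
  refine (norm_sub_le _ _).trans (add_le_add ?_ ?_)
  · rw [norm_mul, norm_neg, norm_pow]
    gcongr
    exact h₂ _ (by simpa using h6)
  · rw [norm_mul]
    gcongr
    · exact h₁ y h3 h4
    · exact h₂ _ (by simpa using h5)

theorem tendsto_sinShift {n : ℕ → ℕ} (hn : Tendsto n atTop atTop) {y : ℕ → ℂ} {z : ℂ}
    (hz : |z.re| ≤ 2) (hy : Tendsto y atTop (𝓝 z)) :
    Tendsto (fun m => sinShift (n m) (y m)) atTop (𝓝 (-(Complex.cos z / csinc z))) := by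
  have hinv : Tendsto (fun m => ((n m : ℂ))⁻¹) atTop (𝓝 0) :=
    (tendsto_inv_atTop_nhds_zero_nat (𝕜 := ℂ)).comp hn
  have h1 : Tendsto (fun m => csinc (y m / n m)) atTop (𝓝 1) := by
    have := (continuous_csinc.tendsto (z * 0)).comp (hy.mul hinv)
    rw [mul_zero, csinc_zero] at this
    exact this
  have h2 : Tendsto (fun m => csinc (y m / (2 * n m))) atTop (𝓝 1) := by
    have := (continuous_csinc.tendsto (z * (2⁻¹ * 0))).comp (hy.mul (hinv.const_mul 2⁻¹))
    rw [mul_zero, mul_zero, csinc_zero] at this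
    refine this.congr fun m => ?_
    simp only [Function.comp, div_eq_mul_inv, mul_inv]
  have h3 : Tendsto (fun m => y m ^ 2 / (2 * n m)) atTop (𝓝 0) := by
    have := (hy.pow 2).mul (hinv.const_mul 2⁻¹)
    rw [mul_zero, mul_zero] at this
    refine this.congr fun m => ?_
    simp only [div_eq_mul_inv, mul_inv]
  have h4 := (h3.neg.mul (h2.pow 2)).sub (((continuousAt_cos_div_csinc hz).tendsto.comp hy).mul h1)
  simpa [sinShift] using h4

theorem integral_cos_div_csinc : ∫ x in (0 : ℝ)..(1 / 2),
    -(Complex.cos ((2 * π * x - π / 2 : ℝ) : ℂ) / csinc ((2 * π * x - π / 2 : ℝ) : ℂ)) =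
      -((Real.log 2 / 2 : ℝ) : ℂ) := by
  have h := intervalIntegral.integral_comp_mul_sub (a := 0) (b := 1 / 2) (c := 2 * π)
    (fun x => Real.cos x / Real.sinc x) (by positivity) (π / 2)
  rw [show 2 * π * 0 - π / 2 = -(π / 2) by ring, show 2 * π * (1 / 2) - π / 2 = π / 2 by ring,
    integral_cos_div_sinc_symm] at h
  rw [intervalIntegral.integral_neg]
  congr 1
  rw [show Real.log 2 / 2 = (2 * π)⁻¹ • (Real.log 2 * π) by
    rw [smul_eq_mul]; field_simp [Real.pi_ne_zero], ← h, ← intervalIntegral.integral_ofReal]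
  refine intervalIntegral.integral_congr fun x _ => ?_
  simp only [csinc_ofReal, Complex.ofReal_div, Complex.ofReal_cos]

theorem tendsto_prod_sinShift (α : ℂ) : Tendsto (fun M : ℕ => ∏ l ∈ Finset.range M,
    (1 + sinShift ((2 * M + 1 : ℕ) : ℂ) (halfNode α M l) / ((2 * M + 1 : ℕ) : ℂ))) atTop
      (𝓝 (Complex.exp (-((Real.log 2 / 2 : ℝ) : ℂ)))) := by
  obtain ⟨B, hB, h⟩ := norm_sinShift_le
  have hcast : ∀ M : ℕ, ((2 * M + 1 : ℕ) : ℝ) = 2 * M + 1 := fun M => by push_cast; ring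
  have hsum : Tendsto (fun M : ℕ => (∑ l ∈ Finset.range M,
      sinShift ((2 * M + 1 : ℕ) : ℂ) (halfNode α M l)) / ((2 * M + 1 : ℕ) : ℂ)) atTop
      (𝓝 (-((Real.log 2 / 2 : ℝ) : ℂ))) := by
    rw [← integral_cos_div_csinc]
    refine tendsto_riemann_sum (r := fun M => M) tendsto_two_mul_add_one
      (Eventually.of_forall fun M => by omega) (by norm_num) ?_ hB ?_ ?_
    · have h1 := (tendsto_const_div_atTop_nhds_zero_nat (1 : ℝ)).const_add 2
      have h2 := h1.inv₀ (by norm_num)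
      rw [add_zero] at h2
      rw [one_div]
      refine h2.congr' ?_
      filter_upwards [eventually_gt_atTop 0] with M hM
      have : (0 : ℝ) < M := Nat.cast_pos.2 hM
      rw [hcast]
      field_simp
    · filter_upwards [halfNode_bounds α] with M hM l hl
      exact h _ _ (by omega) (hM l hl).1 (hM l hl).2
    · intro x hx0 hx1
      have hπ := Real.pi_pos
      have hπ2 := Real.pi_lt_d2
      refine tendsto_sinShift tendsto_two_mul_add_one ?_ ?_
      · rw [Complex.ofReal_re, abs_le]
        constructor <;> nlinarith
      · have hfl : Tendsto (fun M : ℕ => (⌊((2 * M + 1 : ℕ) : ℝ) * x⌋₊ : ℝ) / M) atTop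
            (𝓝 (x * 2)) := by
          have h1 : Tendsto (fun n : ℕ => (⌊x * (n : ℝ)⌋₊ : ℝ) / n) atTop (𝓝 x) :=
            (tendsto_nat_floor_mul_div_atTop hx0.le).comp tendsto_natCast_atTop_atTop
          have h2 := (tendsto_const_div_atTop_nhds_zero_nat (1 : ℝ)).const_add 2
          rw [add_zero] at h2
          refine ((h1.comp tendsto_two_mul_add_one).mul h2).congr' ?_
          filter_upwards [eventually_gt_atTop 0] with M hM
          have : (0 : ℝ) < M := Nat.cast_pos.2 hM
          simp only [Function.comp]
          rw [mul_comm x, hcast]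
          field_simp
        have hfl' := (Complex.continuous_ofReal.tendsto _).comp hfl
        have hinv : Tendsto (fun M : ℕ => (M : ℂ)⁻¹) atTop (𝓝 0) :=
          tendsto_inv_atTop_nhds_zero_nat (𝕜 := ℂ)
        have h3 := ((hfl'.const_mul (π : ℂ)).add (hinv.const_mul (π + α / 2 - π / 4))).sub_const
          (π / 2 : ℂ)
        have e : (π : ℂ) * ((x * 2 : ℝ) : ℂ) + (π + α / 2 - π / 4) * 0 - π / 2 =
            ((2 * π * x - π / 2 : ℝ) : ℂ) := by
          push_cast
          ring
        rw [e] at h3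
        refine h3.congr' ?_
        filter_upwards [eventually_gt_atTop 0] with M hM
        have : (M : ℂ) ≠ 0 := Nat.cast_ne_zero.2 hM.ne'
        simp only [Function.comp, halfNode]
        push_cast
        field_simp
        ring
  refine tendsto_prod_one_add (δ := fun M : ℕ => B / ((2 * M + 1 : ℕ) : ℝ)) (C := B)
    (fun M => by positivity)
    ((tendsto_const_div_atTop_nhds_zero_nat B).comp tendsto_two_mul_add_one) ?_ ?_ ?_
  · filter_upwards [halfNode_bounds α] with M hM l hl
    rw [norm_div, Complex.norm_natCast]
    gcongr
    exact h _ _ (by omega) (hM l hl).1 (hM l hl).2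
  · refine Eventually.of_forall fun M => ?_
    have hpos : (0 : ℝ) < ((2 * M + 1 : ℕ) : ℝ) := by positivity
    rw [mul_div_assoc', div_le_iff₀ hpos, hcast]
    have : (0 : ℝ) ≤ M := Nat.cast_nonneg M
    nlinarith
  · exact hsum.congr fun M => Finset.sum_div _ _ _

theorem half_product (α β : ℂ) : ∃ ρ : ℕ → ℂ,
    Tendsto ρ atTop (𝓝 (Complex.exp (β / 2 - ((Real.log 2 / 2 : ℝ) : ℂ)))) ∧
    ∀ᶠ M : ℕ in atTop, (-1) ^ M * dilProd (2 * M + 1) α β M =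
      2 * Complex.sin (π * (2 * M + 1) / 4 - α / 2) * ρ M := by
  refine ⟨fun M => Complex.exp (β * M / (2 * M + 1)) * ∏ l ∈ Finset.range M,
    (1 + sinShift ((2 * M + 1 : ℕ) : ℂ) (halfNode α M l) / ((2 * M + 1 : ℕ) : ℂ)), ?_, ?_⟩
  · rw [sub_eq_add_neg, Complex.exp_add]
    refine Tendsto.mul (Tendsto.cexp ?_) (tendsto_prod_sinShift α)
    have hinv : Tendsto (fun M : ℕ => (M : ℂ)⁻¹) atTop (𝓝 0) :=
      tendsto_inv_atTop_nhds_zero_nat (𝕜 := ℂ)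
    have h := ((hinv.const_add 2).inv₀ (by simp)).const_mul β
    rw [add_zero] at h
    refine h.congr' ?_
    filter_upwards [eventually_gt_atTop 0] with M hM
    have : (M : ℂ) ≠ 0 := Nat.cast_ne_zero.2 hM.ne'
    have hnc : (2 * M + 1 : ℂ) ≠ 0 := by exact_mod_cast (by omega : 2 * M + 1 ≠ 0)
    field_simp
  · filter_upwards [eventually_gt_atTop 0, halfNode_bounds α] with M hM hb
    have hnc : ((2 * M + 1 : ℕ) : ℂ) ≠ 0 := by exact_mod_cast (by omega : 2 * M + 1 ≠ 0)
    rw [half_product_eq hM, ← prod_two_mul_sin_half hM, mul_left_comm, ← Finset.prod_mul_distrib]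
    congr 1
    refine Finset.prod_congr rfl fun l hl => ?_
    have := sin_shift (y := halfNode α M l) hnc (hb l (Finset.mem_range.1 hl)).1
    rw [halfNode] at this
    rw [this, halfNode, mul_assoc]

theorem norm_sin_ofReal_sub_le (x : ℝ) (z : ℂ) : ‖Complex.sin (x - z)‖ ≤ Real.exp ‖z‖ := by
  rw [Complex.sin, norm_div, norm_mul, Complex.norm_I, Complex.norm_ofNat, mul_one, div_le_iff₀ two_pos]
  refine (norm_sub_le _ _).trans ?_
  rw [Complex.norm_exp, Complex.norm_exp]
  have h := abs_le.1 (Complex.abs_im_le_norm z)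
  have h1 : Real.exp (-(x - z) * Complex.I).re ≤ Real.exp ‖z‖ :=
    Real.exp_le_exp.2 (by simp; linarith)
  have h2 : Real.exp ((x - z) * Complex.I).re ≤ Real.exp ‖z‖ :=
    Real.exp_le_exp.2 (by simp; linarith)
  linarith

theorem exists_bound_half_product (α β : ℂ) : ∃ K : ℝ, ∀ᶠ M : ℕ in atTop,
    ‖dilProd (2 * M + 1) α β M‖ ≤ K := by
  obtain ⟨ρ, hρ, h⟩ := half_product α β
  refine ⟨2 * Real.exp ‖α / 2‖ * (‖Complex.exp (β / 2 - ((Real.log 2 / 2 : ℝ) : ℂ))‖ + 1), ?_⟩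
  filter_upwards [h, hρ.norm.eventually_lt_const (lt_add_one _)] with M hM hb
  have e : ‖dilProd (2 * M + 1) α β M‖ = ‖(-1) ^ M * dilProd (2 * M + 1) α β M‖ := by simp
  rw [e, hM, norm_mul, norm_mul, Complex.norm_ofNat]
  have := norm_sin_ofReal_sub_le (π * (2 * M + 1) / 4) (α / 2)
  push_cast at this
  gcongr

end HalfPeriodLimit

section Assembly
open Topology MeasureTheory Real

theorem dil_add_half (M : ℕ) (α β : ℂ) (l : ℕ) :
    dil (2 * M + 1) α β (M + l) = -dil (2 * M + 1) (α - π) β l := by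
  have hnc : (2 * M + 1 : ℂ) ≠ 0 := by exact_mod_cast (by omega : 2 * M + 1 ≠ 0)
  rw [dil, dil, ← mul_neg, ← mul_neg, ← Complex.cos_add_pi]
  congr 3
  push_cast
  field_simp
  ring

theorem dilProd_add_half (M : ℕ) (α β : ℂ) (r : ℕ) : dilProd (2 * M + 1) α β (M + r) =
    dilProd (2 * M + 1) α β M * ((-1) ^ r * dilProd (2 * M + 1) (α - π) β r) := by
  rw [dilProd, Finset.prod_range_add, dilProd, dilProd]
  congr 1
  have h : (-1 : ℂ) ^ r = ∏ _l ∈ Finset.range r, (-1 : ℂ) := by simp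
  rw [h, ← Finset.prod_mul_distrib]
  refine Finset.prod_congr rfl fun l _ => ?_
  rw [add_assoc, dil_add_half]
  ring

theorem sum_dilProd_split (M : ℕ) (α β : ℂ) :
    ∑ j ∈ Finset.range (2 * M + 1), (-1) ^ j * dilProd (2 * M + 1) α β j =
      ∑ j ∈ Finset.range (M + 1), (-1) ^ j * dilProd (2 * M + 1) α β j +
      (-1) ^ M * dilProd (2 * M + 1) α β M *
        (∑ r ∈ Finset.range (M + 1), dilProd (2 * M + 1) (α - π) β r - 1) := by
  have h0 : dilProd (2 * M + 1) (α - π) β 0 = 1 := by simp [dilProd]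
  rw [Finset.sum_range_succ' (fun r => dilProd (2 * M + 1) (α - π) β r) M, h0,
    add_sub_cancel_right, show 2 * M + 1 = M + 1 + M by ring, Finset.sum_range_add, Finset.mul_sum, show M + 1 + M = 2 * M + 1 by ring]
  congr 1
  refine Finset.sum_congr rfl fun r _ => ?_
  rw [show M + 1 + r = M + (r + 1) by ring, dilProd_add_half, pow_add]
  have : (-1 : ℂ) ^ (r + 1) * (-1) ^ (r + 1) = 1 := by rw [← mul_pow]; simp
  linear_combination ((-1) ^ M * dilProd (2 * M + 1) α β M *
    dilProd (2 * M + 1) (α - π) β (r + 1)) * this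

theorem tendsto_sum_dilProd_full (α β : ℂ) (c : ℕ) :
    Tendsto (fun m : ℕ => (∑ j ∈ Finset.range (2 * (4 * m + c) + 1),
      (-1) ^ j * dilProd (2 * (4 * m + c) + 1) α β j) / (lapScale (2 * (4 * m + c) + 1) : ℂ)) atTop
      (𝓝 (2 * Complex.sin (π * (2 * c + 1) / 4 - α / 2) *
        Complex.exp (β / 2 - ((Real.log 2 / 2 : ℝ) : ℂ)) *
        (dilConst (α - π) β * ((3 : ℝ) ^ (-(1 / 4 : ℝ)) : ℝ)))) := by
  obtain ⟨ρ, hρ, hhalf⟩ := half_product α β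
  obtain ⟨K, hK⟩ := exists_bound_half_product α β
  obtain ⟨K', hK'⟩ := exists_bound_half_product (α - π) β
  have hM : Tendsto (fun m : ℕ => 4 * m + c) atTop atTop :=
    tendsto_atTop_mono (fun m => by simp only [id]; omega) tendsto_id
  have h1 := (tendsto_sum_half_alternating α β hK).comp hM
  have h2 := (tendsto_sum_half (α - π) β hK').comp hM
  have h3 := (Complex.continuous_ofReal.tendsto _).comp
    ((tendsto_one_div_lapScale.comp tendsto_two_mul_add_one).comp hM)
  rw [Complex.ofReal_zero] at h3
  have h4 := h1.add (((hρ.comp hM).const_mul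
    (2 * Complex.sin (π * (2 * c + 1) / 4 - α / 2))).mul (h2.sub h3))
  rw [zero_add, sub_zero] at h4
  refine h4.congr' ?_
  filter_upwards [hM.eventually hhalf] with m hm
  rw [sum_dilProd_split, hm]
  have e : (π * (2 * ((4 * m + c : ℕ) : ℂ) + 1) / 4 - α / 2 : ℂ) =
      π * (2 * c + 1) / 4 - α / 2 + (m : ℤ) * (2 * π) := by
    push_cast
    ring
  rw [e, Complex.sin_add_int_mul_two_pi]
  simp only [Function.comp, Complex.ofReal_div, Complex.ofReal_one]
  ring

theorem qdlAux_eq_dilProd (n : ℕ) (hn : 0 < n) (U V : ℂ) (k : ℤ) (j : ℕ) :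
    qdlAux n (Complex.exp (U / n)) (Complex.exp (V / n)) j =
      Complex.exp ((π * Complex.I * k * j - π * Complex.I * j ^ 2) / n) *
      dilProd n (Complex.I * U / 2) (U / 2 - V - π * Complex.I - π * Complex.I * k) j := by
  have hnc : (n : ℂ) ≠ 0 := Nat.cast_ne_zero.2 hn.ne'
  induction j with
  | zero => simp [qdlAux, dilProd]
  | succ j ih =>
    have e1 : qdlAux n (Complex.exp (U / n)) (Complex.exp (V / n)) (j + 1) =
        qdlAux n (Complex.exp (U / n)) (Complex.exp (V / n)) j * (Complex.exp (-(V / n)) *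
        (1 + Complex.exp ((U - 4 * π * Complex.I * (j + 1)) / n))) := by
      rw [qdlAux, qdlAux, Finset.prod_range_succ, pow_succ, ← Complex.exp_neg, ← Complex.exp_int_mul,
        ← Complex.exp_add]
      have : U / n + ((-(2 * ((j : ℤ) + 1)) : ℤ) : ℂ) * (2 * π * Complex.I / n) =
          (U - 4 * π * Complex.I * (j + 1)) / n := by
        push_cast
        field_simp
        ring
      rw [this]
      ring
    have e2 : 1 + Complex.exp ((U - 4 * π * Complex.I * (j + 1)) / n) =
        Complex.exp ((U / 2 - 2 * π * Complex.I * (j + 1)) / n) *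
          (2 * Complex.cos ((2 * π * ((j + 1 : ℕ) : ℂ) + Complex.I * U / 2) / n)) := by
      have h1 : (2 * π * ((j + 1 : ℕ) : ℂ) + Complex.I * U / 2) / n * Complex.I =
          -((U / 2 - 2 * π * Complex.I * (j + 1)) / n) := by
        push_cast
        field_simp
        linear_combination U * Complex.I_sq
      have h2 : (U - 4 * π * Complex.I * (j + 1)) / n =
          (U / 2 - 2 * π * Complex.I * (j + 1)) / n +
            (U / 2 - 2 * π * Complex.I * (j + 1)) / n := by
        ring
      rw [Complex.two_cos, neg_mul, h1, h2, neg_neg, mul_add (Complex.exp _), ← Complex.exp_add,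
        ← Complex.exp_add, add_neg_cancel, Complex.exp_zero]
    rw [e1, ih, e2, dilProd, dilProd, Finset.prod_range_succ, dil]
    have e3 : Complex.exp ((π * Complex.I * k * j - π * Complex.I * j ^ 2) / n) *
        (Complex.exp (-(V / n)) * Complex.exp ((U / 2 - 2 * π * Complex.I * (j + 1)) / n)) =
        Complex.exp ((π * Complex.I * k * (j + 1 : ℕ) - π * Complex.I * (j + 1 : ℕ) ^ 2) / n) *
        Complex.exp ((U / 2 - V - π * Complex.I - π * Complex.I * k) / n) := by
      rw [← Complex.exp_add, ← Complex.exp_add, ← Complex.exp_add]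
      congr 1
      push_cast
      field_simp
      ring
    linear_combination (∏ l ∈ Finset.range j, dil n (Complex.I * U / 2)
      (U / 2 - V - π * Complex.I - π * Complex.I * k) (l + 1)) *
      (2 * Complex.cos ((2 * π * ((j + 1 : ℕ) : ℂ) + Complex.I * U / 2) / n)) * e3

theorem exp_int_mul_pi_mul_I (a : ℤ) : Complex.exp (a * (π * Complex.I)) = (-1) ^ a := by
  rw [Complex.exp_int_mul, Complex.exp_pi_mul_I]

theorem weight_eq {n : ℕ} (hn : Odd n) {k : ℤ} (hk : Even k) {i a : ℤ} {j : ℕ}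
    (h : 2 * i = j + a * n) :
    Complex.exp ((π * Complex.I * k * j - π * Complex.I * j ^ 2) / n) *
      Complex.exp (2 * π * Complex.I / n) ^ (2 * i ^ 2 - k * i) = (-1) ^ j := by
  have hnc : (n : ℂ) ≠ 0 := Nat.cast_ne_zero.2 hn.pos.ne'
  have h' : (2 * i : ℂ) = j + a * n := by exact_mod_cast h
  rw [← Complex.exp_int_mul, ← Complex.exp_add]
  have e : (π * Complex.I * k * j - π * Complex.I * j ^ 2) / n +
      ((2 * i ^ 2 - k * i : ℤ) : ℂ) * (2 * π * Complex.I / n) =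
      ((2 * j * a + a ^ 2 * n - k * a : ℤ) : ℂ) * (π * Complex.I) := by
    push_cast
    field_simp
    linear_combination (2 * i + j + a * n - k) * h'
  rw [e, exp_int_mul_pi_mul_I, ← zpow_natCast (-1 : ℂ) j]
  obtain ⟨b, hb⟩ := hn
  obtain ⟨k', hk'⟩ := hk
  have hpar : (2 * j * a + a ^ 2 * n - k * a : ℤ) =
      j + (2 * (j * a + a ^ 2 * b - k' * a - i + a * b) + a * (a + 1)) := by
    rw [hb] at h ⊢
    rw [hk']
    push_cast at h ⊢
    linear_combination h
  have heven : Even (2 * (j * a + a ^ 2 * b - k' * a - i + a * b) + a * (a + 1)) :=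
    (even_two_mul _).add (Int.even_mul_succ_self a)
  rw [hpar, zpow_add₀ (by norm_num), heven.neg_one_zpow, mul_one]

theorem sum_Icc_two_mul_mod {n : ℕ} (hn : Odd n) (g : ℕ → ℂ) :
    ∑ i ∈ Finset.Icc 1 n, g (2 * i % n) = ∑ j ∈ Finset.range n, g j := by
  have hmaps : Set.MapsTo (fun i => 2 * i % n) (Finset.Icc 1 n : Set ℕ) (Finset.range n : Set ℕ) := by
    intro i _
    simpa using Nat.mod_lt _ hn.pos
  have hinj : Set.InjOn (fun i => 2 * i % n) (Finset.Icc 1 n : Set ℕ) := by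
    intro i hi i' hi' h
    rw [Finset.mem_coe, Finset.mem_Icc] at hi hi'
    have h1 : i ≡ i' [MOD n] :=
      Nat.ModEq.cancel_left_of_coprime (Nat.coprime_two_right.2 hn) h
    refine h1.eq_of_abs_lt ?_
    rw [abs_lt]
    constructor <;> omega
  exact Finset.sum_nbij _ hmaps hinj
    (Finset.surjOn_of_injOn_of_card_le _ hmaps hinj (by simp)) fun _ _ => rfl

theorem sum_QDL {n : ℕ} (hn : Odd n) (U V : ℂ) {k : ℤ} (hk : Even k) :
    ∑ i ∈ Finset.Icc 1 n, QDL n (Complex.exp (U / n)) (Complex.exp (V / n)) (2 * (i : ℤ)) *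
        Complex.exp (2 * π * Complex.I / n) ^ (2 * (i : ℤ) ^ 2 - k * i) =
      ∑ j ∈ Finset.range n, (-1) ^ j *
        dilProd n (Complex.I * U / 2) (U / 2 - V - π * Complex.I - π * Complex.I * k) j := by
  rw [← sum_Icc_two_mul_mod hn]
  refine Finset.sum_congr rfl fun i _ => ?_
  have h1 : (2 * (i : ℤ) % n).toNat = 2 * i % n := by
    rw [show (2 * (i : ℤ) % n) = ((2 * i % n : ℕ) : ℤ) by push_cast; rfl, Int.toNat_natCast]
  have h2 : 2 * (i : ℤ) = (2 * i % n : ℕ) + ((2 * i / n : ℕ) : ℤ) * n := by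
    exact_mod_cast (Nat.mod_add_div' (2 * i) n).symm
  rw [QDL, h1, qdlAux_eq_dilProd n hn.pos U V k, ← weight_eq hn hk h2]
  ring

theorem logCosInt_eq_lob : logCosInt (1 / 6) = lob (π / 6) / (2 * π) := by
  have hπ := Real.pi_pos
  have hls : ∀ a b : ℝ, IntervalIntegrable (fun t => Real.log (Real.sin t)) volume a b :=
    fun a b => intervalIntegrable_log_sin
  have hae : ∀ a b : ℝ, 0 ≤ a → b ≤ π / 2 → a ≤ b → ∫ t in a..b, Real.log (2 * Real.sin t) =
      ∫ t in a..b, (Real.log 2 + Real.log (Real.sin t)) := by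
    intro a b ha hb hab
    rw [intervalIntegral.integral_of_le hab, intervalIntegral.integral_of_le hab]
    refine setIntegral_congr_fun measurableSet_Ioc fun t ht => ?_
    have := Real.sin_pos_of_pos_of_lt_pi (ha.trans_lt ht.1) (by linarith [ht.2])
    exact Real.log_mul two_ne_zero this.ne'
  have h1 : logCosInt (1 / 6) = (2 * π)⁻¹ * ∫ t in (π / 6)..(π / 2), Real.log (2 * Real.sin t) := by
    have h2 := intervalIntegral.integral_comp_sub_mul (a := 0) (b := 1 / 6) (c := 2 * π)
      (fun x => Real.log (2 * Real.sin x)) (by positivity) (π / 2)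
    simp only [Real.sin_pi_div_two_sub, smul_eq_mul] at h2
    rw [show π / 2 - 2 * π * (1 / 6) = π / 6 by ring, mul_zero, sub_zero] at h2
    exact h2
  have h3 : lob (π / 6) = -∫ t in (0 : ℝ)..(π / 6), Real.log (2 * Real.sin t) := by
    rw [lob]
    simp only [Real.log_abs]
  have h4 := intervalIntegral.integral_add_adjacent_intervals (hls 0 (π / 6)) (hls (π / 6) (π / 2))
  rw [integral_log_sin_zero_pi_div_two] at h4
  rw [h1, h3, hae _ _ (by positivity) le_rfl (by linarith),
    hae _ _ le_rfl (by linarith) (by positivity), intervalIntegral.integral_add (by simp) (hls _ _),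
    intervalIntegral.integral_add (by simp) (hls _ _)]
  simp only [intervalIntegral.integral_const, smul_eq_mul]
  rw [eq_div_iff (by positivity)]
  field_simp
  linarith

theorem log_half_sub_sqrt_three : Complex.log ((1 - Complex.I * (√3 : ℂ)) / 2) =
    -(π / 3 : ℝ) * Complex.I := by
  have hπ := Real.pi_pos
  have h : Complex.exp (-(π / 3 : ℝ) * Complex.I) = (1 - Complex.I * (√3 : ℂ)) / 2 := by
    rw [← Complex.ofReal_neg, Complex.exp_mul_I, ← Complex.ofReal_cos, ← Complex.ofReal_sin,
      Real.cos_neg, Real.sin_neg, Real.cos_pi_div_three, Real.sin_pi_div_three]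
    push_cast
    ring
  rw [← h, Complex.log_exp]
  · simp; linarith
  · simp; linarith

theorem limit_value (U V : ℂ) (k : ℤ) (c : ℕ) :
    2 * Complex.sin (π * (2 * c + 1) / 4 - Complex.I * U / 2 / 2) *
      Complex.exp ((U / 2 - V - π * Complex.I - π * Complex.I * k) / 2 -
        ((Real.log 2 / 2 : ℝ) : ℂ)) *
      dilConst (Complex.I * U / 2 - π) (U / 2 - V - π * Complex.I - π * Complex.I * k) =
    (2 : ℂ) ^ ((U - 2 * π * Complex.I) / (4 * π * Complex.I)) *
      Complex.exp (-((2 * c + 1 : ℕ) : ℂ) * π * Complex.I / 4) *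
      Complex.exp (-2 * (k : ℂ) * π * Complex.I / 3) *
      Complex.exp (-2 * V / 3) *
      (1 - Complex.I ^ (2 * c + 1) * Complex.exp (U / 2)) *
      ((1 - Complex.I * (√3 : ℂ)) / 2) ^ ((2 * π * Complex.I - U) / (4 * π * Complex.I)) := by
  have hπ : (π : ℂ) ≠ 0 := Complex.ofReal_ne_zero.2 Real.pi_ne_zero
  have hI := Complex.I_ne_zero
  have h3 : (1 - Complex.I * (√3 : ℂ)) / 2 ≠ 0 := by
    intro h
    have := congrArg Complex.re h
    simp at this
  have hsin : 2 * Complex.sin (π * (2 * c + 1) / 4 - Complex.I * U / 2 / 2) =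
      Complex.exp (π / 2 * Complex.I) *
        Complex.exp (-((2 * c + 1 : ℕ) : ℂ) * π * Complex.I / 4) * Complex.exp (-(U / 4)) *
        (1 - Complex.I ^ (2 * c + 1) * Complex.exp (U / 2)) := by
    have hIp : Complex.I ^ (2 * c + 1) = Complex.exp ((2 * c + 1 : ℕ) * (π / 2 * Complex.I)) := by
      rw [Complex.exp_nat_mul, Complex.exp_pi_div_two_mul_I]
    have e1 : -(π * (2 * c + 1) / 4 - Complex.I * U / 2 / 2) * Complex.I =
        -((2 * c + 1 : ℕ) : ℂ) * π * Complex.I / 4 + -(U / 4) := by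
      push_cast
      linear_combination (U / 4) * Complex.I_sq
    have e2 : (π * (2 * c + 1) / 4 - Complex.I * U / 2 / 2) * Complex.I =
        (-((2 * c + 1 : ℕ) : ℂ) * π * Complex.I / 4 + -(U / 4)) +
          ((2 * c + 1 : ℕ) * (π / 2 * Complex.I) + U / 2) := by
      push_cast
      linear_combination (-U / 4) * Complex.I_sq
    rw [Complex.two_sin, e1, e2, hIp, Complex.exp_pi_div_two_mul_I]
    simp only [Complex.exp_add]
    ring
  rw [hsin, dilConst, Complex.cpow_def_of_ne_zero two_ne_zero, Complex.cpow_def_of_ne_zero h3,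
    log_half_sub_sqrt_three]
  have hlog : Complex.log 2 = (Real.log 2 : ℂ) := by simp
  rw [hlog]
  set P := 1 - Complex.I ^ (2 * c + 1) * Complex.exp (U / 2)
  set A := Complex.exp (-((2 * c + 1 : ℕ) : ℂ) * π * Complex.I / 4)
  have key : Complex.exp (π / 2 * Complex.I) * Complex.exp (-(U / 4)) *
      Complex.exp ((U / 2 - V - π * Complex.I - π * Complex.I * k) / 2 -
        ((Real.log 2 / 2 : ℝ) : ℂ)) *
      Complex.exp ((U / 2 - V - π * Complex.I - π * Complex.I * k) / 6 -
        (Complex.I * U / 2 - π) * (Real.log 2 / (2 * π)) - Real.log 2 / 2) =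
      Complex.exp (Real.log 2 * ((U - 2 * π * Complex.I) / (4 * π * Complex.I))) *
      Complex.exp (-2 * (k : ℂ) * π * Complex.I / 3) * Complex.exp (-2 * V / 3) *
      Complex.exp (-(π / 3 : ℝ) * Complex.I * ((2 * π * Complex.I - U) / (4 * π * Complex.I))) := by
    simp only [← Complex.exp_add]
    congr 1
    push_cast
    have e1 : (U - 2 * π * Complex.I) / (4 * π * Complex.I) = -(Complex.I * U) / (4 * π) - 1 / 2 := by
      field_simp
      linear_combination (2 * U) * Complex.I_sq
    have e2 : (2 * π * Complex.I - U) / (4 * π * Complex.I) = Complex.I * U / (4 * π) + 1 / 2 := by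
      field_simp
      linear_combination (-2 * U) * Complex.I_sq
    rw [e1, e2]
    field_simp
    ring_nf
    rw [Complex.I_sq]
    ring
  linear_combination A * P * key

end Assembly

/-- Asymptotics of `Σₙ = Σ_{i=1}^n QDL^q(u,v | 2i) q^{2i² − k̂ i}`
as `n = 8m+n₀` tends to `∞` in a fixed congruence class `n₀ ∈ {1,3,5,7}` mod 8,
when `k̂` is even. -/
theorem sigma_asymptotics_even
    (U V : ℂ) (hUV : Complex.exp V = 1 + Complex.exp U)
    (k : ℤ) (hk : Even k)
    (n₀ : ℕ) (hn₀ : n₀ = 1 ∨ n₀ = 3 ∨ n₀ = 5 ∨ n₀ = 7) :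
    Tendsto (fun m : ℕ =>
      (∑ i ∈ Finset.Icc 1 (8 * m + n₀),
          QDL (8 * m + n₀) (Complex.exp (U / (8 * m + n₀)))
              (Complex.exp (V / (8 * m + n₀))) (2 * (i : ℤ)) *
            Complex.exp (2 * Real.pi * Complex.I / (8 * m + n₀)) ^ (2 * (i : ℤ) ^ 2 - k * i)) /
        ((Real.sqrt (8 * m + n₀) *
            Real.exp (((8 * m + n₀ : ℝ) / (2 * Real.pi)) * lob (Real.pi / 6)) : ℝ) : ℂ))
      atTop
      (nhds ((((3 : ℝ) ^ (-(1 / 4 : ℝ)) : ℝ) : ℂ) *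
        (2 : ℂ) ^ ((U - 2 * Real.pi * Complex.I) / (4 * Real.pi * Complex.I)) *
        Complex.exp (-(n₀ : ℂ) * Real.pi * Complex.I / 4) *
        Complex.exp (-2 * (k : ℂ) * Real.pi * Complex.I / 3) *
        Complex.exp (-2 * V / 3) *
        (1 - Complex.I ^ n₀ * Complex.exp (U / 2)) *
        ((1 - Complex.I * (Real.sqrt 3 : ℂ)) / 2) ^
          ((2 * Real.pi * Complex.I - U) / (4 * Real.pi * Complex.I)))) := by
  obtain ⟨c, rfl⟩ : ∃ c, n₀ = 2 * c + 1 := by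
    rcases hn₀ with rfl | rfl | rfl | rfl
    exacts [⟨0, rfl⟩, ⟨1, rfl⟩, ⟨2, rfl⟩, ⟨3, rfl⟩]
  have h := tendsto_sum_dilProd_full (Complex.I * U / 2)
    (U / 2 - V - Real.pi * Complex.I - Real.pi * Complex.I * k) c
  rw [← mul_assoc, limit_value, mul_comm _ (((3 : ℝ) ^ (-(1 / 4 : ℝ)) : ℝ) : ℂ)] at h
  simp only [← mul_assoc] at h
  refine h.congr fun m => ?_
  have hodd : Odd (8 * m + (2 * c + 1)) := ⟨4 * m + c, by ring⟩
  have hsum := sum_QDL hodd U V hk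
  have hcast : ((8 * m + (2 * c + 1) : ℕ) : ℂ) = 8 * m + ((2 * c + 1 : ℕ) : ℂ) := by push_cast; rfl
  have hcastR : ((8 * m + (2 * c + 1) : ℕ) : ℝ) = 8 * m + ((2 * c + 1 : ℕ) : ℝ) := by push_cast; rfl
  rw [show 2 * (4 * m + c) + 1 = 8 * m + (2 * c + 1) by ring, ← hsum, lapScale, logCosInt_eq_lob,
    hcast, hcastR, mul_div_assoc', div_mul_eq_mul_div]
end

section
/- The integral ∫₀^{1/4} t · cot(2πt) dt converges (the integrand extends continuously to [0, 1/4] with value 1/(2π) at t = 0) and equals (log 2)/(8π). -/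
open Real Set Filter Topology MeasureTheory in
/-- The function `x cot x` is integrable on `[0, π/2]`, being measurable and bounded by `1`. -/
theorem intervalIntegrable_mul_cot :
    IntervalIntegrable (fun x : ℝ => x * Real.cot x) volume 0 (π / 2) := by
  have hmeas : Measurable fun x : ℝ => x * Real.cot x := by
    simp_rw [Real.cot_eq_cos_div_sin]
    fun_prop
  refine (intervalIntegrable_const (c := (1 : ℝ))).mono_fun' hmeas.aestronglyMeasurable ?_
  rw [uIoc_of_le (by positivity)]
  filter_upwards [ae_restrict_mem measurableSet_Ioc] with x hx
  have hsin : 0 < sin x := sin_pos_of_pos_of_lt_pi hx.1 (by linarith [hx.2, pi_pos])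
  have hcos : 0 ≤ cos x := cos_nonneg_of_mem_Icc ⟨by linarith [hx.1, pi_pos], hx.2⟩
  have hle : x * cos x ≤ sin x := by
    rcases hx.2.lt_or_eq with h | h
    · have hcos' : 0 < cos x := cos_pos_of_mem_Ioo ⟨by linarith [hx.1, pi_pos], h⟩
      have := lt_tan hx.1 h
      rw [tan_eq_sin_div_cos, lt_div_iff₀ hcos'] at this
      exact this.le
    · simp [h]
  rw [Real.cot_eq_cos_div_sin, Real.norm_of_nonneg (by have := hx.1; positivity),
    mul_div_assoc', div_le_one hsin]
  exact hle

open Real Set Filter Topology MeasureTheory in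
theorem tendsto_mul_log_sin_nhdsGT_zero :
    Tendsto (fun x : ℝ => x * log (sin x)) (𝓝[>] 0) (𝓝 0) := by
  have hlower : Tendsto (fun x : ℝ => π / 2 * (sin x * log (sin x))) (𝓝[>] 0) (𝓝 0) := by
    have h : Continuous fun x : ℝ => π / 2 * (sin x * log (sin x)) :=
      (continuous_mul_log.comp continuous_sin).const_mul _
    simpa using (h.tendsto 0).mono_left nhdsWithin_le_nhds
  refine tendsto_of_tendsto_of_tendsto_of_le_of_le' hlower tendsto_const_nhds ?_ ?_ <;>
    filter_upwards [Ioo_mem_nhdsGT (show (0 : ℝ) < π / 2 by positivity)] with x hx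
  · have hx' : x ≤ π / 2 * sin x := by
      have := mul_le_sin hx.1.le hx.2.le
      calc x = π / 2 * (2 / π * x) := by field_simp
        _ ≤ _ := by gcongr
    have hlog : log (sin x) ≤ 0 :=
      log_nonpos (sin_nonneg_of_nonneg_of_le_pi hx.1.le (by linarith [hx.2, pi_pos]))
        (sin_le_one x)
    rw [← mul_assoc]
    exact mul_le_mul_of_nonpos_right hx' hlog
  · exact mul_nonpos_of_nonneg_of_nonpos hx.1.le
      (log_nonpos (sin_nonneg_of_nonneg_of_le_pi hx.1.le (by linarith [hx.2, pi_pos]))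
        (sin_le_one x))

open Real Set Filter Topology MeasureTheory in
/-- Integration by parts reduces the integral of `x cot x` to that of `log (sin x)`. -/
theorem integral_mul_cot :
    ∫ x in (0 : ℝ)..(π / 2), x * Real.cot x = π / 2 * log 2 := by
  have hlogsin : IntervalIntegrable (fun x : ℝ => log (sin x)) volume 0 (π / 2) :=
    intervalIntegrable_log_sin
  have hderiv : ∀ x ∈ Ioo 0 (π / 2),
      HasDerivAt (fun x : ℝ => x * log (sin x)) (log (sin x) + x * Real.cot x) x := by
    intro x hx
    have hsin : sin x ≠ 0 :=
      (sin_pos_of_pos_of_lt_pi hx.1 (by linarith [hx.2, pi_pos])).ne'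
    refine ((hasDerivAt_id' x).mul ((hasDerivAt_sin x).log hsin)).congr_deriv ?_
    rw [one_mul, Real.cot_eq_cos_div_sin]
  have hright : Tendsto (fun x : ℝ => x * log (sin x)) (𝓝[<] (π / 2)) (𝓝 0) := by
    have h : ContinuousAt (fun x : ℝ => x * log (sin x)) (π / 2) :=
      continuousAt_id.mul (continuous_sin.continuousAt.log (by simp))
    simpa [ContinuousAt] using h.tendsto.mono_left nhdsWithin_le_nhds
  have h := intervalIntegral.integral_eq_sub_of_hasDerivAt_of_tendsto (by positivity) hderiv
    (hlogsin.add intervalIntegrable_mul_cot) tendsto_mul_log_sin_nhdsGT_zero hright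
  rw [intervalIntegral.integral_add hlogsin intervalIntegrable_mul_cot,
    integral_log_sin_zero_pi_div_two] at h
  linarith


/-- `∫₀^{1/4} t cot(2πt) dt` converges and equals `(log 2)/(8π)`. -/
theorem integral_t_cot :
    IntervalIntegrable (fun t : ℝ => t * Real.cot (2 * Real.pi * t))
      MeasureTheory.volume 0 (1 / 4 : ℝ) ∧
    ∫ t in (0:ℝ)..(1 / 4 : ℝ), t * Real.cot (2 * Real.pi * t) = Real.log 2 / (8 * Real.pi) := by
  have hpi : 2 * Real.pi ≠ 0 := by positivity
  have hfun : (fun t : ℝ => t * Real.cot (2 * Real.pi * t)) =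
      fun t => (2 * Real.pi)⁻¹ * (2 * Real.pi * t * Real.cot (2 * Real.pi * t)) := by
    funext t
    field_simp
  have hend : 2 * Real.pi * (1 / 4) = Real.pi / 2 := by ring
  rw [hfun]
  constructor
  · have h := intervalIntegrable_mul_cot.comp_mul_left (c := 2 * Real.pi)
    rw [zero_div, ← hend, mul_div_cancel_left₀ _ hpi] at h
    exact h.const_mul _
  · rw [intervalIntegral.integral_const_mul,
      intervalIntegral.integral_comp_mul_left (fun x => x * Real.cot x) hpi, mul_zero, hend,
      integral_mul_cot, smul_eq_mul]
    field_simp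
    norm_num
end
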